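/- arXiv:1612.07073 — 3 statements merged into one kernel-verified Lean document; each statement's English description precedes it below -/
import Mathlib

section
/- For any two continua K⁻ and K⁺ in the Riemann sphere, there exists an entire function f : ℂ → ℂ (differentiable on all of ℂ) such that deriv f x ≠ 0 for every real x, the cluster set at −∞ of the real restriction t ↦ f(t) equals K⁻, and the cluster set at +∞ of t ↦ f(t) equals K⁺. -/
open Filter Topology

/-- Infinitely many finite nonempty `R`-chains, each starting where the previous one ended,
concatenate to one infinite `R`-chain. -/
theorem exists_seq_of_transGen {α : Type*} {R : α → α → Prop} {s : ℕ → α}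
    (h : ∀ n, Relation.TransGen R (s n) (s (n + 1))) :
    ∃ (u : ℕ → α) (φ : ℕ → ℕ), StrictMono φ ∧ (∀ k, R (u k) (u (k + 1))) ∧
      ∀ n, u (φ n) = s n := by
  have hchain : ∀ {a b : α}, Relation.TransGen R a b →
      ∃ (L : ℕ) (c : ℕ → α), 0 < L ∧ c 0 = a ∧ c L = b ∧ ∀ i < L, R (c i) (c (i + 1)) := by
    intro a b hab
    induction hab using Relation.TransGen.head_induction_on with
    | @single a hab =>
      refine ⟨1, fun i => if i = 0 then a else b, one_pos, by simp, by simp, ?_⟩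
      intro i hi
      obtain rfl : i = 0 := by omega
      simpa using hab
    | @head a x hax _ ih =>
      obtain ⟨L, c, _, hc0, hcL, hc⟩ := ih
      refine ⟨L + 1, fun i => Nat.casesOn i a c, by omega, rfl, hcL, ?_⟩
      intro i hi
      cases i with
      | zero => simpa [hc0] using hax
      | succ i => exact hc i (by omega)
  choose L c hL hc0 hcL hc using fun n => hchain (h n)
  let next : ℕ × ℕ → ℕ × ℕ := fun p => if p.2 + 1 < L p.1 then (p.1, p.2 + 1) else (p.1 + 1, 0)
  let st : ℕ → ℕ × ℕ := fun k => next^[k] (0, 0)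
  have hst : ∀ k, st (k + 1) = next (st k) := fun k => Function.iterate_succ_apply' _ _ _
  have hinv : ∀ k, (st k).2 < L (st k).1 := by
    intro k
    induction k with
    | zero => exact hL 0
    | succ k ih =>
      rw [hst]
      by_cases hk : (st k).2 + 1 < L (st k).1
      · simp [next, hk]
      · simp [next, hk, hL]
  let φ : ℕ → ℕ := fun n => ∑ k ∈ Finset.range n, L k
  have hφ : ∀ n, φ (n + 1) = φ n + L n := fun n => Finset.sum_range_succ _ _
  have hwalk : ∀ n, st (φ n) = (n, 0) → ∀ i < L n, st (φ n + i) = (n, i) := by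
    intro n hn i
    induction i with
    | zero => intro _; simpa using hn
    | succ i ih =>
      intro hi
      rw [← add_assoc, hst, ih (by omega)]
      simp [next, hi]
  have hstart : ∀ n, st (φ n) = (n, 0) := by
    intro n
    induction n with
    | zero => rfl
    | succ n ih =>
      have hLn := hL n
      have h1 := hwalk n ih (L n - 1) (by omega)
      have h2 : φ (n + 1) = (φ n + (L n - 1)) + 1 := by rw [hφ]; omega
      rw [h2, hst, h1]
      have h3 : ¬ (L n - 1 + 1 < L n) := by omega
      simp only [next, if_neg h3]
  refine ⟨fun k => c (st k).1 (st k).2, φ, ?_, ?_, ?_⟩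
  · refine strictMono_nat_of_lt_succ fun n => ?_
    rw [hφ]
    exact Nat.lt_add_of_pos_right (hL n)
  · intro k
    have hk := hinv k
    have hstep := hc (st k).1 (st k).2 hk
    by_cases hlt : (st k).2 + 1 < L (st k).1
    · simpa [hst, next, hlt] using hstep
    · have heq : (st k).2 + 1 = L (st k).1 := by omega
      rw [heq, hcL] at hstep
      simpa [hst, next, hlt, hc0] using hstep
  · intro n
    simp [hstart, hc0]

theorem isPreconnected_setOf_le_norm {r : ℝ} (hr : 0 < r) : IsPreconnected {z : ℂ | r ≤ ‖z‖} := by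
  have h : {z : ℂ | r ≤ ‖z‖} = Complex.exp '' {w : ℂ | Real.log r ≤ w.re} := by
    ext z
    constructor
    · intro (hz : r ≤ ‖z‖)
      have hz0 : z ≠ 0 := norm_pos_iff.mp (hr.trans_le hz)
      refine ⟨Complex.log z, ?_, Complex.exp_log hz0⟩
      simpa [Complex.log_re] using Real.log_le_log hr hz
    · rintro ⟨w, hw : Real.log r ≤ w.re, rfl⟩
      simpa [Complex.norm_exp] using (Real.log_le_iff_le_exp hr).mp hw
  rw [h]
  exact (convex_halfSpace_re_ge _).isPreconnected.image _ Complex.continuous_exp.continuousOn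

theorem IsPreconnected.reflTransGen_dist_le {X : Type*} [PseudoMetricSpace X] {S T : Set X}
    (hT : IsPreconnected T) (hTS : T ⊆ S) {ε : ℝ} (hε : 0 < ε) {x y : X} (hx : x ∈ T) (hy : y ∈ T) :
    Relation.ReflTransGen (fun a b => a ∈ S ∧ b ∈ S ∧ dist a b ≤ ε) x y := by
  refine hT.induction₂' _ (fun a ha => ?_) (fun _ _ _ _ _ _ => Relation.ReflTransGen.trans) hx hy
  filter_upwards [self_mem_nhdsWithin, mem_nhdsWithin_of_mem_nhds (Metric.ball_mem_nhds a hε)]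
    with b hb hab
  rw [Metric.mem_ball] at hab
  exact ⟨.single ⟨hTS ha, hTS hb, by rw [dist_comm]; exact hab.le⟩,
    .single ⟨hTS hb, hTS ha, hab.le⟩⟩

/-- The trace on `ℂ` of a subset `K` of the Riemann sphere, together with the exterior of a disc
if `K` contains the point at infinity. -/
def OnePoint.fattenedTrace (K : Set (OnePoint ℂ)) (r : ℝ) : Set ℂ :=
  {z | (z : OnePoint ℂ) ∈ K ∨ ((OnePoint.infty : OnePoint ℂ) ∈ K ∧ r ≤ ‖z‖)}

theorem OnePoint.fattenedTrace_anti (K : Set (OnePoint ℂ)) : Antitone (fattenedTrace K) :=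
  fun _ _ hrs _ hz => hz.imp_right fun h => ⟨h.1, hrs.trans h.2⟩

theorem OnePoint.coe_tendsto_infty {ι : Type*} {l : Filter ι} {u : ι → ℂ} :
    Tendsto (fun i => (u i : OnePoint ℂ)) l (𝓝 OnePoint.infty) ↔
      Tendsto (fun i => ‖u i‖) l atTop := by
  rw [tendsto_norm_atTop_iff_cobounded, Metric.cobounded_eq_cocompact,
    ← coclosedCompact_eq_cocompact, ← OnePoint.comap_coe_nhds_infty, tendsto_comap_iff]
  rfl

theorem OnePoint.coe_tendsto_coe {ι : Type*} {l : Filter ι} {u : ι → ℂ} {a : ℂ} :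
    Tendsto (fun i => (u i : OnePoint ℂ)) l (𝓝 (a : OnePoint ℂ)) ↔ Tendsto u l (𝓝 a) := by
  rw [← OnePoint.comap_coe_nhds a, tendsto_comap_iff]
  rfl

theorem OnePoint.reflTransGen_fattenedTrace {K : Set (OnePoint ℂ)} (hK : IsPreconnected K)
    {r ε : ℝ} (hr : 0 < r) (hε : 0 < ε) {a b : ℂ} (ha : a ∈ fattenedTrace K r)
    (hb : b ∈ fattenedTrace K r) :
    Relation.ReflTransGen
      (fun x y => x ∈ fattenedTrace K r ∧ y ∈ fattenedTrace K r ∧ dist x y ≤ ε) a b := by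
  set C : ℂ → ℂ → Prop := Relation.ReflTransGen
    (fun x y => x ∈ fattenedTrace K r ∧ y ∈ fattenedTrace K r ∧ dist x y ≤ ε)
  let rep : OnePoint ℂ → Set ℂ := fun x => {z | (z : OnePoint ℂ) = x ∨ (x = infty ∧ r ≤ ‖z‖)}
  have hrep : ∀ z ∈ fattenedTrace K r, ∃ x ∈ K, z ∈ rep x := by
    rintro z (hz | ⟨hK', hz⟩)
    · exact ⟨z, hz, .inl rfl⟩
    · exact ⟨infty, hK', .inr ⟨rfl, hz⟩⟩
  have hrep_coe : ∀ x : ℂ, rep x = {x} := by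
    intro x
    ext z
    simp [rep]
  have hrep_infty : rep infty = {z : ℂ | r ≤ ‖z‖} := by
    ext z
    simp [rep]
  have hne : ∀ x, (rep x).Nonempty := by
    intro x
    induction x using OnePoint.rec with
    | infty => exact ⟨r, by simp [hrep_infty, le_abs_self]⟩
    | coe x => exact ⟨x, .inl rfl⟩
  have key : ∀ x ∈ K, ∀ y ∈ K, ∀ a ∈ rep x, ∀ b ∈ rep y, C a b := by
    intro x hx y hy
    refine hK.induction₂' (fun x y => ∀ a ∈ rep x, ∀ b ∈ rep y, C a b) (fun x hx => ?_)
      (fun x y z _ _ _ hxy hyz a ha b hb => ?_) hx hy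
    · induction x using OnePoint.rec with
      | infty =>
        have hsub : {z : ℂ | r ≤ ‖z‖} ⊆ fattenedTrace K r := fun z hz => .inr ⟨hx, hz⟩
        have hconn : ∀ a b : ℂ, r ≤ ‖a‖ → r ≤ ‖b‖ → C a b := fun a b ha hb =>
          (isPreconnected_setOf_le_norm hr).reflTransGen_dist_le hsub hε ha hb
        have hev : ∀ᶠ y in 𝓝 (infty : OnePoint ℂ), ∀ z ∈ rep y, r ≤ ‖z‖ := by
          rw [OnePoint.nhds_infty_eq, eventually_sup, eventually_map]
          refine ⟨?_, by simp [hrep_infty]⟩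
          rw [coclosedCompact_eq_cocompact, ← Metric.cobounded_eq_cocompact]
          filter_upwards [tendsto_norm_cobounded_atTop.eventually_ge_atTop r] with z hz
          simpa [hrep_coe] using hz
        filter_upwards [mem_nhdsWithin_of_mem_nhds hev] with y hy
        rw [hrep_infty]
        exact ⟨fun a ha b hb => hconn a b ha (hy b hb), fun a ha b hb => hconn a b (hy a ha) hb⟩
      | coe x =>
        rw [OnePoint.nhdsWithin_coe, eventually_map]
        filter_upwards [self_mem_nhdsWithin,
          mem_nhdsWithin_of_mem_nhds (Metric.ball_mem_nhds x hε)] with y hy hxy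
        rw [Metric.mem_ball] at hxy
        simp only [hrep_coe, Set.mem_singleton_iff, forall_eq]
        exact ⟨.single ⟨.inl hx, .inl hy, by rw [dist_comm]; exact hxy.le⟩,
          .single ⟨.inl hy, .inl hx, hxy.le⟩⟩
    · obtain ⟨c, hc⟩ := hne y
      exact (hxy a ha c hc).trans (hyz c hc b hb)
  obtain ⟨x, hx, hax⟩ := hrep a ha
  obtain ⟨y, hy, hby⟩ := hrep b hb
  exact key x hx y hy a hax b hby

theorem OnePoint.mem_of_forall_mem_closure_fattenedTrace {K : Set (OnePoint ℂ)} (hK : IsClosed K)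
    {w : OnePoint ℂ}
    (hw : ∀ n : ℕ, w ∈ closure ((↑) '' fattenedTrace K (n + 1 : ℝ))) : w ∈ K := by
  by_cases hinf : (infty : OnePoint ℂ) ∈ K
  · have h : ∀ n : ℕ, w ∈ K ∪ ((↑) '' Metric.ball (0 : ℂ) (n + 1))ᶜ := by
      intro n
      refine closure_minimal ?_
        (hK.union (OnePoint.isOpen_image_coe.mpr Metric.isOpen_ball).isClosed_compl) (hw n)
      rintro _ ⟨z, hz | ⟨-, hz⟩, rfl⟩
      · exact .inl hz
      · refine .inr ?_
        rintro ⟨z', hz', heq⟩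
        rw [OnePoint.coe_injective heq, mem_ball_zero_iff] at hz'
        exact absurd hz' (not_lt.mpr hz)
    induction w using OnePoint.rec with
    | infty => exact hinf
    | coe z =>
      obtain ⟨n, hn⟩ := exists_nat_gt ‖z‖
      refine (h n).resolve_right fun hz => hz ⟨z, ?_, rfl⟩
      rw [mem_ball_zero_iff]
      linarith
  · refine closure_minimal ?_ hK (hw 0)
    rintro _ ⟨z, hz | ⟨hz, -⟩, rfl⟩
    · exact hz
    · exact absurd hz hinf

theorem OnePoint.exists_countable_subset_closure (K : Set (OnePoint ℂ)) :
    ∃ T ⊆ K, T.Countable ∧ K ⊆ closure T := by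
  obtain ⟨c, hcK, hc, hKc⟩ := (TopologicalSpace.IsSeparable.of_separableSpace
    ((↑) ⁻¹' K : Set ℂ)).exists_countable_dense_subset
  refine ⟨(↑) '' c ∪ ({infty} ∩ K), ?_, ?_, ?_⟩
  · rintro _ (⟨z, hz, rfl⟩ | ⟨-, hz⟩)
    exacts [hcK hz, hz]
  · exact (hc.image _).union ((Set.countable_singleton _).mono Set.inter_subset_left)
  · intro w hw
    induction w using OnePoint.rec with
    | infty => exact subset_closure (.inr ⟨rfl, hw⟩)
    | coe z =>
      exact closure_mono Set.subset_union_left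
        (image_closure_subset_closure_image OnePoint.continuous_coe ⟨z, hKc hw, rfl⟩)

theorem OnePoint.exists_seq_mem_fattenedTrace {K : Set (OnePoint ℂ)} (hne : K.Nonempty) :
    ∃ p : ℕ → ℂ, (∀ n : ℕ, p n ∈ fattenedTrace K (n + 1)) ∧
      ∀ w ∈ K, MapClusterPt w atTop fun n => (p n : OnePoint ℂ) := by
  obtain ⟨T, hTK, hT, hKT⟩ := OnePoint.exists_countable_subset_closure K
  have hTne : T.Nonempty := closure_nonempty_iff.mp (hne.mono hKT)
  obtain ⟨q, rfl⟩ := hT.exists_eq_range hTne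
  have hP : ∀ k, ∃ P : ℕ → ℂ, (∀ n : ℕ, P n ∈ fattenedTrace K (n + 1)) ∧
      Tendsto (fun n => (P n : OnePoint ℂ)) atTop (𝓝 (q k)) := by
    intro k
    have hk : q k ∈ K := hTK ⟨k, rfl⟩
    generalize q k = x at hk
    induction x using OnePoint.rec with
    | infty =>
      have hnorm : ∀ n : ℕ, ‖((n : ℂ) + 1)‖ = n + 1 := fun n => by
        exact_mod_cast Complex.norm_natCast (n + 1)
      refine ⟨fun n => n + 1, fun n => .inr ⟨hk, (hnorm n).ge⟩, ?_⟩
      rw [OnePoint.coe_tendsto_infty]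
      simp only [hnorm]
      exact tendsto_atTop_add_const_right _ _ tendsto_natCast_atTop_atTop
    | coe z => exact ⟨fun _ => z, fun _ => .inl hk, tendsto_const_nhds⟩
  choose P hPmem hPlim using hP
  refine ⟨fun n => P n.unpair.1 n, fun n => hPmem _ n, ?_⟩
  have hclosed : IsClosed
      {w : OnePoint ℂ | MapClusterPt w atTop fun n => (P n.unpair.1 n : OnePoint ℂ)} :=
    isClosed_setOfPred_clusterPt
  refine fun w hw => closure_minimal ?_ hclosed (hKT hw)
  rintro _ ⟨k, rfl⟩
  have hpair : Tendsto (fun j => Nat.pair k j) atTop atTop :=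
    tendsto_atTop_mono (fun j => Nat.right_le_pair k j) tendsto_id
  refine MapClusterPt.of_comp hpair (Tendsto.mapClusterPt ?_)
  simpa [Function.comp_def] using (hPlim k).comp hpair

/-- Every continuum in the Riemann sphere is the set of accumulation points of a sequence in the
plane whose increments tend to zero. -/
theorem OnePoint.exists_seq_mapClusterPt_eq {K : Set (OnePoint ℂ)} (hKc : IsCompact K)
    (hK : IsConnected K) :
    ∃ u : ℕ → ℂ, Tendsto (fun n => dist (u n) (u (n + 1))) atTop (𝓝 0) ∧
      {w : OnePoint ℂ | MapClusterPt w atTop fun n => (u n : OnePoint ℂ)} = K := by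
  obtain ⟨p, hp, hpK⟩ := OnePoint.exists_seq_mem_fattenedTrace hK.nonempty
  let S : ℕ → Set ℂ := fun n => fattenedTrace K (n + 1)
  have hS : Antitone S := fun m n hmn => fattenedTrace_anti K (by gcongr)
  let R : ℕ × ℂ → ℕ × ℂ → Prop := fun x y =>
    x.2 ∈ S x.1 ∧ x.1 ≤ y.1 ∧ dist x.2 y.2 ≤ 1 / ((x.1 : ℝ) + 1)
  have hR : ∀ n, Relation.TransGen R (n, p n) (n + 1, p (n + 1)) := by
    intro n
    have hpn : p (n + 1) ∈ S n := hS n.le_succ (hp (n + 1))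
    refine Relation.TransGen.tail' (b := (n, p (n + 1))) ?_
      ⟨hpn, n.le_succ, by simp only [dist_self]; positivity⟩
    refine (OnePoint.reflTransGen_fattenedTrace hK.isPreconnected (by positivity)
      (Nat.one_div_pos_of_nat (n := n)) (hp n) hpn).lift (fun z => (n, z)) ?_
    exact fun a b hab => ⟨hab.1, le_rfl, hab.2.2⟩
  obtain ⟨u, φ, hφ, hu, huφ⟩ := exists_seq_of_transGen hR
  have hmono : Monotone fun k => (u k).1 := monotone_nat_of_le_succ fun k => (hu k).2.1
  have htop : Tendsto (fun k => (u k).1) atTop atTop :=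
    tendsto_atTop_atTop_of_monotone hmono fun n => ⟨φ n, by simp [huφ]⟩
  refine ⟨fun k => (u k).2, ?_, Set.Subset.antisymm ?_ ?_⟩
  · exact squeeze_zero (fun _ => dist_nonneg) (fun k => (hu k).2.2)
      (tendsto_one_div_add_atTop_nhds_zero_nat.comp htop)
  · intro w hw
    refine OnePoint.mem_of_forall_mem_closure_fattenedTrace hKc.isClosed fun n => ?_
    rw [mem_closure_iff_clusterPt]
    refine ClusterPt.mono hw (le_principal_iff.mpr ?_)
    rw [mem_map]
    filter_upwards [htop.eventually_ge_atTop n] with k hk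
    exact ⟨_, hS hk (hu k).1, rfl⟩
  · intro w hw
    refine MapClusterPt.of_comp hφ.tendsto_atTop ?_
    simpa [Function.comp_def, huφ] using hpK w hw


theorem integrable_exp_mul_abs_sub_mul_sq {b : ℝ} (hb : 0 < b) (a : ℝ) :
    MeasureTheory.Integrable fun t : ℝ => Real.exp (a * |t| - b * t ^ 2) := by
  refine ((integrable_exp_neg_mul_sq (half_pos hb)).const_mul (Real.exp (a ^ 2 / (2 * b)))).mono'
    (by fun_prop) (MeasureTheory.ae_of_all _ fun t => ?_)
  rw [Real.norm_eq_abs, Real.abs_exp, ← Real.exp_add, Real.exp_le_exp]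
  have h : a ^ 2 / (2 * b) + -(b / 2) * t ^ 2 - (a * |t| - b * t ^ 2)
      = (a - b * |t|) ^ 2 / (2 * b) := by
    field_simp
    rw [← sq_abs t]
    ring
  have h' : 0 ≤ (a - b * |t|) ^ 2 / (2 * b) := by positivity
  linarith

/-- The convolution of `g : ℝ → ℂ` with the Gaussian `exp (-π z ^ 2)`, at complex arguments. -/
noncomputable def gaussianSmoothing (g : ℝ → ℂ) (z : ℂ) : ℂ :=
  ∫ t : ℝ, g t * Complex.exp (-Real.pi * (z - t) ^ 2)

theorem norm_exp_neg_pi_mul_sub_sq_le {z : ℂ} {R : ℝ} (hz : ‖z‖ ≤ R) (t : ℝ) :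
    ‖Complex.exp (-Real.pi * (z - t) ^ 2)‖ ≤
      Real.exp (Real.pi * R ^ 2 + (2 * Real.pi * R) * |t| - Real.pi * t ^ 2) := by
  rw [Complex.norm_exp, Real.exp_le_exp]
  have hre : (-Real.pi * (z - t) ^ 2 : ℂ).re = -Real.pi * ((z.re - t) ^ 2 - z.im ^ 2) := by
    simp [pow_two]
  rw [hre]
  have hre_le : |z.re| ≤ R := (Complex.abs_re_le_norm z).trans hz
  have him : z.im ^ 2 ≤ R ^ 2 :=
    have h := abs_le.mp ((Complex.abs_im_le_norm z).trans hz)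
    sq_le_sq' h.1 h.2
  have hmul : z.re * t ≤ R * |t| := (le_abs_self _).trans <| by
    rw [abs_mul]
    gcongr
  have h : 0 ≤ Real.pi * (R ^ 2 + 2 * (R * |t| - z.re * t) + z.re ^ 2 - z.im ^ 2) :=
    mul_nonneg Real.pi_pos.le (by nlinarith [sq_nonneg z.re])
  nlinarith [h]

theorem differentiable_gaussianSmoothing {g : ℝ → ℂ} (hg : MeasureTheory.AEStronglyMeasurable g)
    {C : ℝ} (hgC : ∀ t, ‖g t‖ ≤ C * Real.exp |t|) : Differentiable ℂ (gaussianSmoothing g) := by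
  intro z₀
  set R : ℝ := ‖z₀‖ + 1
  have hC : 0 ≤ C := by simpa using (norm_nonneg _).trans (hgC 0)
  have hball : ∀ z ∈ Metric.ball z₀ 1, ‖z‖ ≤ R := by
    intro z hz
    rw [mem_ball_iff_norm] at hz
    have := norm_le_norm_add_norm_sub' z z₀
    simp only [R]
    linarith
  have hkernel : ∀ z : ℂ, ‖z‖ ≤ R → ∀ t : ℝ,
      ‖g t * Complex.exp (-Real.pi * (z - t) ^ 2)‖ ≤ C * Real.exp |t| *
        Real.exp (Real.pi * R ^ 2 + (2 * Real.pi * R) * |t| - Real.pi * t ^ 2) := by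
    intro z hz t
    rw [norm_mul]
    gcongr
    exacts [hgC t, norm_exp_neg_pi_mul_sub_sq_le hz t]
  have hmeas : ∀ z : ℂ, MeasureTheory.AEStronglyMeasurable
      (fun t : ℝ => g t * Complex.exp (-Real.pi * (z - t) ^ 2)) := fun z =>
    hg.mul (by fun_prop)
  have hintegrable := fun a : ℝ => integrable_exp_mul_abs_sub_mul_sq Real.pi_pos a
  refine (hasDerivAt_integral_of_dominated_loc_of_deriv_le (Metric.ball_mem_nhds z₀ one_pos)
    (F := fun (z : ℂ) (t : ℝ) => g t * Complex.exp (-Real.pi * (z - t) ^ 2))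
    (F' := fun (z : ℂ) (t : ℝ) =>
      g t * Complex.exp (-Real.pi * (z - t) ^ 2) * (-Real.pi * (2 * (z - t))))
    (bound := fun t => (C * Real.exp (Real.pi * R ^ 2 + R) * (2 * Real.pi)) *
      Real.exp ((2 * Real.pi * R + 2) * |t| - Real.pi * t ^ 2))
    (Eventually.of_forall hmeas) ?_ ((hmeas z₀).mul (by fun_prop)) ?_
    ((hintegrable _).const_mul _) ?_).2.differentiableAt
  · refine ((hintegrable (2 * Real.pi * R + 1)).const_mul (C * Real.exp (Real.pi * R ^ 2))).mono'
      (hmeas z₀) (MeasureTheory.ae_of_all _ fun t => ?_)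
    refine (hkernel z₀ (by simp [R]) t).trans_eq ?_
    rw [mul_assoc, mul_assoc C, ← Real.exp_add, ← Real.exp_add]
    ring_nf
  · refine MeasureTheory.ae_of_all _ fun t z hz => ?_
    have hlin : ‖(-Real.pi * (2 * (z - t)) : ℂ)‖ ≤ 2 * Real.pi * Real.exp (R + |t|) := by
      have h1 : ‖(-Real.pi * (2 * (z - t)) : ℂ)‖ = 2 * Real.pi * ‖z - t‖ := by
        simp [abs_of_pos Real.pi_pos]
        ring
      have h2 : ‖z - t‖ ≤ R + |t| := (norm_sub_le _ _).trans (by simpa using hball z hz)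
      rw [h1]
      gcongr
      linarith [Real.add_one_le_exp (R + |t|)]
    rw [norm_mul]
    refine (mul_le_mul (hkernel z (hball z hz) t) hlin (norm_nonneg _) (by positivity)).trans_eq ?_
    calc _ = C * (2 * Real.pi) * (Real.exp |t| *
          Real.exp (Real.pi * R ^ 2 + (2 * Real.pi * R) * |t| - Real.pi * t ^ 2) *
          Real.exp (R + |t|)) := by ring
      _ = C * (2 * Real.pi) * (Real.exp (Real.pi * R ^ 2 + R) *
          Real.exp ((2 * Real.pi * R + 2) * |t| - Real.pi * t ^ 2)) := by
        simp only [← Real.exp_add]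
        ring_nf
      _ = _ := by ring
  · refine MeasureTheory.ae_of_all _ fun t z _ => ?_
    have h := ((((hasDerivAt_id z).sub_const (t : ℂ)).pow 2).const_mul
      (-Real.pi : ℂ)).cexp.const_mul (g t)
    refine h.congr_deriv ?_
    simp
    ring

theorem tendsto_gaussianSmoothing_sub {g : ℝ → ℂ} (hg : Measurable g) {C : ℝ}
    (hgC : ∀ x y, ‖g x - g y‖ ≤ C * (|x - y| + 1)) {l : Filter ℝ} [l.IsCountablyGenerated]
    (hl : ∀ s, Tendsto (fun x => g (x - s) - g x) l (𝓝 0)) :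
    Tendsto (fun x : ℝ => gaussianSmoothing g x - g x) l (𝓝 0) := by
  have hC : 0 ≤ C := by simpa using (norm_nonneg _).trans (hgC 0 0)
  have hgauss : MeasureTheory.Integrable fun s : ℝ => Real.exp (-Real.pi * s ^ 2) :=
    integrable_exp_neg_mul_sq Real.pi_pos
  have hdom : MeasureTheory.Integrable fun s : ℝ =>
      C * Real.exp (1 * |s| - Real.pi * s ^ 2) :=
    (integrable_exp_mul_abs_sub_mul_sq Real.pi_pos 1).const_mul C
  have hbound : ∀ x s : ℝ, ‖(g (x - s) - g x) * (Real.exp (-Real.pi * s ^ 2) : ℂ)‖ ≤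
      C * Real.exp (1 * |s| - Real.pi * s ^ 2) := by
    intro x s
    have h1 : ‖g (x - s) - g x‖ ≤ C * Real.exp |s| := by
      refine (hgC _ _).trans ?_
      rw [show x - s - x = -s by ring, abs_neg]
      gcongr
      exact Real.add_one_le_exp _
    have h2 : (1 * |s| - Real.pi * s ^ 2) = |s| + -Real.pi * s ^ 2 := by ring
    rw [norm_mul, Complex.norm_real, Real.norm_eq_abs, Real.abs_exp, h2, Real.exp_add, ← mul_assoc]
    gcongr
  have hmeas : ∀ x : ℝ, MeasureTheory.AEStronglyMeasurable
      fun s : ℝ => (g (x - s) - g x) * (Real.exp (-Real.pi * s ^ 2) : ℂ) := fun x =>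
    Measurable.aestronglyMeasurable (by fun_prop)
  have hrepr : ∀ x : ℝ, gaussianSmoothing g x - g x =
      ∫ s : ℝ, (g (x - s) - g x) * (Real.exp (-Real.pi * s ^ 2) : ℂ) := by
    intro x
    have hconst : ∫ s : ℝ, g x * (Real.exp (-Real.pi * s ^ 2) : ℂ) = g x := by
      rw [MeasureTheory.integral_const_mul, integral_complex_ofReal, integral_gaussian,
        div_self Real.pi_ne_zero, Real.sqrt_one, Complex.ofReal_one, mul_one]
    have hintegrable : MeasureTheory.Integrable
        fun s : ℝ => (g (x - s) - g x) * (Real.exp (-Real.pi * s ^ 2) : ℂ) :=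
      hdom.mono' (hmeas x) (MeasureTheory.ae_of_all _ (hbound x))
    have hshift : gaussianSmoothing g x =
        ∫ s : ℝ, ((g (x - s) - g x) * (Real.exp (-Real.pi * s ^ 2) : ℂ) +
          g x * (Real.exp (-Real.pi * s ^ 2) : ℂ)) := by
      rw [gaussianSmoothing, ← MeasureTheory.integral_sub_left_eq_self _ _ x]
      congr 1 with s
      push_cast
      ring_nf
    have hadd := MeasureTheory.integral_add hintegrable (hgauss.ofReal.const_mul (g x))
    rw [sub_eq_iff_eq_add, hshift]
    exact hadd.trans (congrArg _ hconst)
  simp only [hrepr]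
  rw [← MeasureTheory.integral_zero ℝ ℂ]
  refine MeasureTheory.tendsto_integral_filter_of_dominated_convergence _
    (Eventually.of_forall hmeas)
    (Eventually.of_forall fun x => MeasureTheory.ae_of_all _ (hbound x)) hdom
    (MeasureTheory.ae_of_all _ fun s => ?_)
  simpa only [zero_mul] using (hl s).mul_const (Real.exp (-Real.pi * s ^ 2) : ℂ)

theorem dist_le_mul_abs_sub_of_dist_succ_le {X : Type*} [PseudoMetricSpace X] {v : ℕ → X} {N : ℕ}
    {ε : ℝ} (hv : ∀ k ≥ N, dist (v k) (v (k + 1)) ≤ ε) {m n : ℕ} (hm : N ≤ m) (hn : N ≤ n) :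
    dist (v m) (v n) ≤ ε * |(m : ℝ) - n| := by
  wlog hmn : m ≤ n generalizing m n
  · rw [dist_comm, abs_sub_comm]
    exact this hn hm (le_of_not_ge hmn)
  refine (dist_le_Ico_sum_of_dist_le hmn (d := fun _ => ε)
    fun {k} hk _ => hv k (hm.trans hk)).trans_eq ?_
  rw [Finset.sum_const, Nat.card_Ico, nsmul_eq_mul, Nat.cast_sub hmn, abs_sub_comm,
    abs_of_nonneg (sub_nonneg.mpr (Nat.cast_le.mpr hmn)), mul_comm]

theorem abs_natFloor_sub_natFloor_le (x y : ℝ) :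
    |(⌊x⌋₊ : ℝ) - ⌊y⌋₊| ≤ |x - y| + 1 := by
  wlog hxy : y ≤ x generalizing x y
  · rw [abs_sub_comm, abs_sub_comm x]
    exact this y x (le_of_not_ge hxy)
  rw [abs_of_nonneg (sub_nonneg.mpr (Nat.cast_le.mpr (Nat.floor_mono hxy))),
    abs_of_nonneg (sub_nonneg.mpr hxy)]
  rcases le_or_gt 0 x with hx | hx
  · linarith [Nat.floor_le hx, Nat.lt_floor_add_one y]
  · rw [Nat.floor_of_nonpos hx.le]
    have : (0 : ℝ) ≤ ⌊y⌋₊ := Nat.cast_nonneg _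
    push_cast
    linarith

/-- Two curves in the plane whose difference tends to zero have the same cluster points on the
Riemann sphere. -/
theorem OnePoint.mapClusterPt_congr_of_tendsto_sub {ι : Type*} {l : Filter ι} {u v : ι → ℂ}
    (h : Tendsto (fun i => u i - v i) l (𝓝 0)) (w : OnePoint ℂ) :
    (MapClusterPt w l fun i => (u i : OnePoint ℂ)) ↔
      MapClusterPt w l fun i => (v i : OnePoint ℂ) := by
  have key : ∀ {u v : ι → ℂ}, Tendsto (fun i => u i - v i) l (𝓝 0) →
      (MapClusterPt w l fun i => (u i : OnePoint ℂ)) →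
        MapClusterPt w l fun i => (v i : OnePoint ℂ) := by
    intro u v h hu
    rw [mapClusterPt_iff_ultrafilter] at hu ⊢
    obtain ⟨U, hUl, hU⟩ := hu
    refine ⟨U, hUl, ?_⟩
    have hUh := h.mono_left hUl
    induction w using OnePoint.rec with
    | infty =>
      rw [OnePoint.coe_tendsto_infty] at hU ⊢
      have hnorm : Tendsto (fun i => -‖u i - v i‖) U (𝓝 0) := by simpa using hUh.norm.neg
      refine tendsto_atTop_mono (fun i => ?_) (hU.atTop_add hnorm)
      linarith [norm_le_norm_add_norm_sub (v i) (u i), norm_sub_rev (u i) (v i)]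
    | coe a =>
      rw [OnePoint.coe_tendsto_coe] at hU ⊢
      simpa using hU.sub hUh
  exact ⟨key h, key (by simpa using h.neg)⟩

theorem mapClusterPt_atTop_natFloor_iff {X : Type*} [TopologicalSpace X] {u : ℕ → X} {w : X} :
    (MapClusterPt w atTop fun t : ℝ => u ⌊t⌋₊) ↔ MapClusterPt w atTop u := by
  refine ⟨fun h => MapClusterPt.of_comp tendsto_nat_floor_atTop h,
    fun h => MapClusterPt.of_comp (tendsto_natCast_atTop_atTop (R := ℝ)) ?_⟩
  simpa [Function.comp_def] using h

theorem exists_entire_mapClusterPt_atTop_eq {K : Set (OnePoint ℂ)} (hKc : IsCompact K)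
    (hK : IsConnected K) :
    ∃ F : ℂ → ℂ, Differentiable ℂ F ∧ Tendsto (fun x : ℝ => F x) atBot (𝓝 0) ∧
      ∀ w, (MapClusterPt w atTop fun x : ℝ => (F x : OnePoint ℂ)) ↔ w ∈ K := by
  obtain ⟨u, hu, huK⟩ := OnePoint.exists_seq_mapClusterPt_eq hKc hK
  let v : ℕ → ℂ := Function.update u 0 0
  have hvu : ∀ n ≠ 0, v n = u n := fun n hn => Function.update_of_ne hn _ _
  have hv0 : v 0 = 0 := Function.update_self _ _ _
  have hv : Tendsto (fun n => dist (v n) (v (n + 1))) atTop (𝓝 0) := by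
    refine hu.congr' ?_
    filter_upwards [eventually_ne_atTop 0] with n hn
    rw [hvu n hn, hvu (n + 1) n.succ_ne_zero]
  obtain ⟨C, hC⟩ := hv.bddAbove_range
  have hvC : ∀ k ≥ 0, dist (v k) (v (k + 1)) ≤ C := fun k _ => hC ⟨k, rfl⟩
  have hC0 : 0 ≤ C := dist_nonneg.trans (hvC 0 le_rfl)
  let g : ℝ → ℂ := fun t => v ⌊t⌋₊
  have hgC : ∀ x y, ‖g x - g y‖ ≤ C * (|x - y| + 1) := by
    intro x y
    rw [← dist_eq_norm]
    refine (dist_le_mul_abs_sub_of_dist_succ_le hvC (Nat.zero_le _) (Nat.zero_le _)).trans ?_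
    exact mul_le_mul_of_nonneg_left (abs_natFloor_sub_natFloor_le x y) hC0
  have hgmeas : Measurable g := (measurable_of_countable v).comp Nat.measurable_floor
  have hg_neg : ∀ x < (0 : ℝ), g x = 0 := fun x hx => by
    simp only [g, Nat.floor_of_nonpos hx.le, hv0]
  have hg_growth : ∀ t, ‖g t‖ ≤ C * Real.exp |t| := by
    intro t
    have h := hgC t 0
    have hg0 : g 0 = 0 := by simp [g, hv0]
    rw [hg0, sub_zero, sub_zero] at h
    exact h.trans (mul_le_mul_of_nonneg_left (Real.add_one_le_exp _) hC0)
  have hbot : ∀ s, Tendsto (fun x => g (x - s) - g x) atBot (𝓝 0) := by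
    intro s
    refine tendsto_const_nhds.congr' ?_
    filter_upwards [eventually_lt_atBot 0, eventually_lt_atBot s] with x hx hxs
    rw [hg_neg x hx, hg_neg (x - s) (by linarith), sub_zero]
  have htop : ∀ s, Tendsto (fun x => g (x - s) - g x) atTop (𝓝 0) := by
    intro s
    rw [Metric.tendsto_atTop]
    intro ε hε
    have hδ : 0 < ε / (|s| + 2) := by positivity
    obtain ⟨N, hN⟩ := eventually_atTop.mp (hv.eventually_le_const hδ)
    refine ⟨N + |s|, fun x hx => ?_⟩
    have h1 : N ≤ ⌊x⌋₊ := Nat.le_floor (by linarith [abs_nonneg s])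
    have h2 : N ≤ ⌊x - s⌋₊ := Nat.le_floor (by linarith [le_abs_self s])
    rw [dist_zero_right, ← dist_eq_norm]
    refine (dist_le_mul_abs_sub_of_dist_succ_le hN h2 h1).trans_lt ?_
    have h3 : |(⌊x - s⌋₊ : ℝ) - ⌊x⌋₊| ≤ |s| + 1 := by
      simpa using abs_natFloor_sub_natFloor_le (x - s) x
    rw [div_mul_eq_mul_div, div_lt_iff₀ (by positivity)]
    exact mul_lt_mul_of_pos_left (by linarith) hε
  refine ⟨gaussianSmoothing g, differentiable_gaussianSmoothing hgmeas.aestronglyMeasurable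
    hg_growth, ?_, fun w => ?_⟩
  · refine (tendsto_gaussianSmoothing_sub hgmeas hgC hbot).congr' ?_
    filter_upwards [eventually_lt_atBot 0] with x hx
    rw [hg_neg x hx, sub_zero]
  · rw [OnePoint.mapClusterPt_congr_of_tendsto_sub (tendsto_gaussianSmoothing_sub hgmeas hgC htop),
      mapClusterPt_atTop_natFloor_iff (u := fun n => (v n : OnePoint ℂ)), ← huK,
      Set.mem_ofPred_eq]
    refine OnePoint.mapClusterPt_congr_of_tendsto_sub (tendsto_const_nhds.congr' ?_) w
    filter_upwards [eventually_ne_atTop 0] with n hn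
    rw [hvu n hn, sub_self]

/-- An entire function that is small on the real line and can be multiplied by a suitable constant
and added to any entire function to remove the critical points on the real line. -/
noncomputable def criticalPointPerturbation (z : ℂ) : ℂ :=
  Complex.exp (-z ^ 2) * (1 + Complex.I * z)

theorem hasDerivAt_criticalPointPerturbation (z : ℂ) :
    HasDerivAt criticalPointPerturbation
      (Complex.exp (-z ^ 2) * (Complex.I - 2 * z - 2 * Complex.I * z ^ 2)) z := by
  have h := (((hasDerivAt_id z).pow 2).neg.cexp).mul
    (((hasDerivAt_id z).const_mul Complex.I).const_add 1)
  refine h.congr_deriv ?_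
  simp
  ring

theorem norm_criticalPointPerturbation_le (x : ℝ) :
    ‖criticalPointPerturbation x‖ ≤ 2 / (1 + |x|) := by
  have hexp : ‖Complex.exp (-(x : ℂ) ^ 2)‖ ≤ 1 / (1 + x ^ 2) := by
    rw [Complex.norm_exp]
    have hre : (-(x : ℂ) ^ 2).re = -x ^ 2 := by simp [pow_two]
    rw [hre, Real.exp_neg, ← one_div]
    gcongr
    linarith [Real.add_one_le_exp (x ^ 2)]
  have hlin : ‖1 + Complex.I * x‖ ≤ 1 + |x| := (norm_add_le _ _).trans (by simp)
  rw [criticalPointPerturbation, norm_mul]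
  refine (mul_le_mul hexp hlin (norm_nonneg _) (by positivity)).trans ?_
  rw [div_mul_eq_mul_div, div_le_div_iff₀ (by positivity) (by positivity)]
  nlinarith [sq_nonneg (1 - |x|), sq_abs x]

theorem tendsto_criticalPointPerturbation {l : Filter ℝ} (hl : Tendsto (fun x => |x|) l atTop) :
    Tendsto (fun x : ℝ => criticalPointPerturbation x) l (𝓝 0) :=
  squeeze_zero_norm norm_criticalPointPerturbation_le
    ((tendsto_atTop_add_const_left _ 1 hl).const_div_atTop 2)

theorem exists_deriv_add_criticalPointPerturbation_ne_zero {F : ℂ → ℂ} (hF : Differentiable ℂ F) :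
    ∃ c : ℂ, ∀ x : ℝ, deriv (fun z => F z + c * criticalPointPerturbation z) x ≠ 0 := by
  let D : ℂ → ℂ := fun z => Complex.exp (-z ^ 2) * (Complex.I - 2 * z - 2 * Complex.I * z ^ 2)
  have hD : ∀ x : ℝ, D x ≠ 0 := by
    intro x
    refine mul_ne_zero (Complex.exp_ne_zero _) fun h => ?_
    have hre := congrArg Complex.re h
    have him := congrArg Complex.im h
    simp [pow_two] at hre him
    subst hre
    simp at him
  have hcont : ∀ {G : ℂ → ℂ}, Differentiable ℂ G → ContDiff ℝ 1 fun x : ℝ => G x := fun hG =>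
    (hG.contDiff.restrict_scalars ℝ).comp Complex.ofRealCLM.contDiff
  have hDdiff : Differentiable ℂ D := by fun_prop
  have hquot : ContDiff ℝ 1 fun x : ℝ => -deriv F x / D x := by
    simp only [div_eq_mul_inv]
    exact (hcont hF.deriv).neg.mul ((hcont hDdiff).inv hD)
  obtain ⟨c, hc⟩ := (hquot.dense_compl_range_of_finrank_lt_finrank
    (by simp [Complex.finrank_real_complex])).nonempty
  refine ⟨c, fun x hx => hc ⟨x, ?_⟩⟩
  have hderiv := (hF x).hasDerivAt.add ((hasDerivAt_criticalPointPerturbation x).const_mul c)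
  have hsum : deriv F x + c * D x = 0 := hderiv.deriv.symm.trans hx
  rw [div_eq_iff (hD x), neg_eq_iff_add_eq_zero]
  exact hsum

/-- For any two continua `K⁻` and `K⁺` in the Riemann sphere `OnePoint ℂ`, there exists an
entire function `f : ℂ → ℂ` with nonvanishing derivative on the real line, whose restriction
to the real line has cluster set `K⁻` at `-∞` and `K⁺` at `+∞`. -/
theorem entire_curve_with_prescribed_cluster_sets
    (Kneg Kpos : Set (OnePoint ℂ))
    (hKnegC : IsCompact Kneg) (hKnegConn : IsConnected Kneg)
    (hKposC : IsCompact Kpos) (hKposConn : IsConnected Kpos) :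
    ∃ f : ℂ → ℂ, Differentiable ℂ f ∧ (∀ x : ℝ, deriv f x ≠ 0) ∧
      {w : OnePoint ℂ | MapClusterPt w atBot fun t : ℝ => ((f t : ℂ) : OnePoint ℂ)} = Kneg ∧
      {w : OnePoint ℂ | MapClusterPt w atTop fun t : ℝ => ((f t : ℂ) : OnePoint ℂ)} = Kpos := by
  obtain ⟨F, hF, hFbot, hFtop⟩ := exists_entire_mapClusterPt_atTop_eq hKposC hKposConn
  obtain ⟨G, hG, hGbot, hGtop⟩ := exists_entire_mapClusterPt_atTop_eq hKnegC hKnegConn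
  have hFG : Differentiable ℂ fun z => F z + G (-z) := hF.add (hG.comp differentiable_neg)
  obtain ⟨c, hc⟩ := exists_deriv_add_criticalPointPerturbation_ne_zero hFG
  have hpert : Differentiable ℂ criticalPointPerturbation := fun z =>
    (hasDerivAt_criticalPointPerturbation z).differentiableAt
  refine ⟨_, hFG.add (hpert.const_mul c), hc, ?_, ?_⟩
  · ext w
    have hflip : (MapClusterPt w atBot fun t : ℝ => ((G (-t : ℂ) : ℂ) : OnePoint ℂ)) ↔
        w ∈ Kneg := by
      rw [← hGtop w, mapClusterPt_def, mapClusterPt_def, ← map_neg_atBot, map_map]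
      simp [Function.comp_def]
    rw [Set.mem_ofPred_eq, ← hflip]
    refine OnePoint.mapClusterPt_congr_of_tendsto_sub ?_ w
    have h := hFbot.add
      ((tendsto_criticalPointPerturbation tendsto_abs_atBot_atTop).const_mul c)
    rw [mul_zero, add_zero] at h
    refine h.congr fun x => ?_
    simp only [Pi.add_apply]
    ring
  · ext w
    rw [Set.mem_ofPred_eq, ← hFtop w]
    refine OnePoint.mapClusterPt_congr_of_tendsto_sub ?_ w
    have h := (hGbot.comp tendsto_neg_atTop_atBot).add
      ((tendsto_criticalPointPerturbation tendsto_abs_atTop_atTop).const_mul c)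
    rw [mul_zero, add_zero] at h
    refine h.congr fun x => ?_
    simp only [Pi.add_apply, Function.comp_apply, Complex.ofReal_neg]
    ring
end

section
/- Let D = ℂ \ ({z : Re z = 0 ∧ Im z ≥ 1} ∪ {z : Re z = 0 ∧ Im z ≤ −1}) be the doubly slit plane (an open set containing ℝ). For any two continua K⁻ and K⁺ in the Riemann sphere, there exists a function G that is analytic on D with deriv G z ≠ 0 for all z ∈ D, such that: (i) the real restriction g(t) = G(t) has cluster set K⁻ at −∞ and K⁺ at +∞; (ii) for every w ∈ OnePoint ℂ, w ∈ K⁺ if and only if there exists a sequence zₙ ∈ D with Re zₙ → +∞ and G(zₙ) → w in OnePoint ℂ, and w ∈ K⁻ if and only if there exists a sequence zₙ ∈ D with Re zₙ → −∞ and G(zₙ) → w; and (iii) there is no c ∈ ℂ such that t ↦ deriv G t / ‖deriv G t‖ (t ∈ ℝ) converges to c as t → +∞, and none as t → −∞. -/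
open Filter Topology

namespace OnePointCluster

theorem tendsto_coe_of_sub_tendsto_zero {ι : Type*} {l : Filter ι} {f g : ι → ℂ}
    (hfg : Tendsto (fun i => f i - g i) l (𝓝 0)) {w : OnePoint ℂ}
    (hg : Tendsto (fun i => (g i : OnePoint ℂ)) l (𝓝 w)) :
    Tendsto (fun i => (f i : OnePoint ℂ)) l (𝓝 w) := by
  induction w using OnePoint.rec with
  | infty =>
    have h1 : Tendsto g l (cocompact ℂ) := by
      rw [← coclosedCompact_eq_cocompact, ← OnePoint.comap_coe_nhds_infty]
      exact tendsto_comap_iff.2 hg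
    refine OnePoint.tendsto_coe_infty.comp ?_
    rw [coclosedCompact_eq_cocompact, ← Metric.cobounded_eq_cocompact] at *
    rw [← tendsto_norm_atTop_iff_cobounded] at *
    refine tendsto_atTop_mono' l ?_ (tendsto_atTop_add_const_right l (-1) h1)
    filter_upwards [(Metric.tendsto_nhds.1 hfg) 1 one_pos] with i hi
    rw [dist_zero_right] at hi
    have := norm_sub_norm_le (g i) (f i)
    rw [norm_sub_rev] at this
    linarith
  | coe w =>
    have h1 : Tendsto g l (𝓝 w) := (OnePoint.isOpenEmbedding_coe.tendsto_nhds_iff).2 hg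
    refine (OnePoint.continuous_coe.tendsto w).comp ?_
    simpa using hfg.add h1

theorem mapClusterPt_coe_of_sub_tendsto_zero {ι : Type*} {l : Filter ι} {f g : ι → ℂ}
    (hfg : Tendsto (fun i => f i - g i) l (𝓝 0)) {w : OnePoint ℂ}
    (hg : MapClusterPt w l fun i => (g i : OnePoint ℂ)) :
    MapClusterPt w l fun i => (f i : OnePoint ℂ) := by
  rw [mapClusterPt_iff_ultrafilter] at hg ⊢
  obtain ⟨U, hU, h⟩ := hg
  exact ⟨U, hU, tendsto_coe_of_sub_tendsto_zero (hfg.mono_left hU) h⟩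

instance firstCountableTopology_onePoint_complex : FirstCountableTopology (OnePoint ℂ) := by
  refine ⟨fun w => ?_⟩
  induction w using OnePoint.rec with
  | infty =>
    rw [OnePoint.nhds_infty_eq, coclosedCompact_eq_cocompact,
      ← Metric.cobounded_eq_cocompact, ← comap_norm_atTop]
    infer_instance
  | coe w =>
    rw [OnePoint.nhds_coe_eq]
    infer_instance

theorem exists_seq_of_forall_transGen {α : Type*} {P : ℕ → α → Prop} {R : ℕ → α → α → Prop}
    (h : ∀ n a, P n a → ∃ b, P (n + 1) b ∧ Relation.TransGen (R n) a b)
    {a₀ : α} (h₀ : P 0 a₀) :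
    ∃ (s : ℕ → α) (N τ : ℕ → ℕ), s 0 = a₀ ∧ (∀ j, R (N j) (s j) (s (j + 1))) ∧
      Tendsto N atTop atTop ∧ Tendsto τ atTop atTop ∧ ∀ n, P n (s (τ n)) := by
  have key : ∀ n a, P n a → ∃ (k : ℕ) (f : ℕ → α), 0 < k ∧ f 0 = a ∧ P (n + 1) (f k) ∧
      ∀ i < k, R n (f i) (f (i + 1)) := by
    intro n a ha
    obtain ⟨b, hb, hab⟩ := h n a ha
    suffices ∃ (k : ℕ) (f : ℕ → α), 0 < k ∧ f 0 = a ∧ f k = b ∧ ∀ i < k, R n (f i) (f (i + 1)) by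
      obtain ⟨k, f, hk, h0, h1, h2⟩ := this
      exact ⟨k, f, hk, h0, h1 ▸ hb, h2⟩
    clear hb ha
    induction hab using Relation.TransGen.head_induction_on with
    | single hab =>
      rename_i a
      exact ⟨1, fun i => if i = 0 then a else b, one_pos, by simp, by simp,
        fun i hi => by simpa [Nat.lt_one_iff.1 hi] using hab⟩
    | head hac hcb ih =>
      rename_i a c
      obtain ⟨k, f, hk, h0, h1, h2⟩ := ih
      refine ⟨k + 1, fun i => Nat.casesOn i a f, k.succ_pos, rfl, h1, ?_⟩
      rintro (_ | i) hi
      · simpa [h0] using hac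
      · exact h2 i (by omega)
  choose! k f hk hf0 hfk hfR using key
  let a : ℕ → α := fun n => n.rec a₀ (fun n a => f n a (k n a))
  have ha : ∀ n, P n (a n) := fun n => by
    induction n with
    | zero => exact h₀
    | succ n ih => exact hfk n _ ih
  let step : ℕ × ℕ → ℕ × ℕ := fun x =>
    if x.2 + 1 < k x.1 (a x.1) then (x.1, x.2 + 1) else (x.1 + 1, 0)
  let pos : ℕ → ℕ × ℕ := fun j => step^[j] (0, 0)
  have hpos : ∀ j, pos (j + 1) = step (pos j) := fun j => Function.iterate_succ_apply' _ _ _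
  have hlt : ∀ j, (pos j).2 < k (pos j).1 (a (pos j).1) := fun j => by
    induction j with
    | zero => exact hk _ _ (ha _)
    | succ j ih =>
      rw [hpos]
      by_cases hc : (pos j).2 + 1 < k (pos j).1 (a (pos j).1)
      · simp [step, hc]
      · simpa [step, hc] using hk _ _ (ha _)
  have hmono : Monotone fun j => (pos j).1 := monotone_nat_of_le_succ fun j => by
    rw [hpos]
    by_cases hc : (pos j).2 + 1 < k (pos j).1 (a (pos j).1) <;> simp [step, hc]
  have hreach : ∀ n, ∃ j, pos j = (n, 0) := fun n => by
    induction n with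
    | zero => exact ⟨0, rfl⟩
    | succ n ih =>
      obtain ⟨j, hj⟩ := ih
      have h1 : ∀ i < k n (a n), pos (j + i) = (n, i) := fun i hi => by
        induction i with
        | zero => exact hj
        | succ i ih =>
          rw [← add_assoc, hpos, ih (by omega)]
          simp [step, hi]
      have hk' := hk n _ (ha n)
      refine ⟨j + (k n (a n) - 1) + 1, ?_⟩
      rw [hpos, h1 _ (by omega)]
      have : ¬ (k n (a n) - 1 + 1 < k n (a n)) := by omega
      simp [step, this]
  choose τ hτ using hreach
  refine ⟨fun j => f (pos j).1 (a (pos j).1) (pos j).2, fun j => (pos j).1, τ, hf0 _ _ (ha 0),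
    fun j => ?_, ?_, ?_, fun n => ?_⟩
  · have h1 := hfR _ _ (ha (pos j).1) _ (hlt j)
    by_cases hc : (pos j).2 + 1 < k (pos j).1 (a (pos j).1)
    · have h2 : pos (j + 1) = ((pos j).1, (pos j).2 + 1) := by rw [hpos]; simp [step, hc]
      simpa only [h2] using h1
    · have h2 : pos (j + 1) = ((pos j).1 + 1, 0) := by rw [hpos]; simp [step, hc]
      have h3 : k (pos j).1 (a (pos j).1) = (pos j).2 + 1 := by have := hlt j; omega
      simp only [h2]
      rw [hf0 _ _ (ha _)]
      rw [← h3] at h1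
      exact h1
  · exact tendsto_atTop_atTop_of_monotone hmono fun n => ⟨τ n, by simp [hτ]⟩
  · refine Function.Injective.nat_tendsto_atTop fun m n hmn => ?_
    have := hτ m
    rw [hmn, hτ n] at this
    exact (Prod.ext_iff.1 this).1.symm
  · simp only [hτ, hf0 _ _ (ha n)]
    exact ha n

theorem transGen_of_isPreconnected {s : Set ℂ} (hs : IsPreconnected s) {δ : ℝ} (hδ : 0 < δ)
    {a b : ℂ} (ha : a ∈ s) (hb : b ∈ s) :
    Relation.TransGen (fun x y => x ∈ s ∧ y ∈ s ∧ ‖y - x‖ < δ) a b := by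
  refine hs.induction₂ (Relation.TransGen fun x y => x ∈ s ∧ y ∈ s ∧ ‖y - x‖ < δ)
    (fun x hx => ?_) (fun _ _ _ _ _ _ => Relation.TransGen.trans) (fun x y _ _ h => ?_) ha hb
  · filter_upwards [self_mem_nhdsWithin, mem_nhdsWithin_of_mem_nhds (Metric.ball_mem_nhds x hδ)]
      with y hy hyx
    exact .single ⟨hx, hy, by rwa [← dist_eq_norm]⟩
  · rw [← Relation.transGen_swap] at h
    exact Relation.TransGen.mono
      (fun u v huv => ⟨huv.2.1, huv.1, by rw [norm_sub_rev]; exact huv.2.2⟩) _ _ h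

theorem isPreconnected_norm_gt {r : ℝ} (hr : 0 < r) : IsPreconnected {z : ℂ | r < ‖z‖} := by
  have h : {z : ℂ | r < ‖z‖} = Complex.exp '' {z : ℂ | Real.log r < z.re} := by
    ext z
    constructor
    · intro (hz : r < ‖z‖)
      have hz0 : z ≠ 0 := norm_pos_iff.1 (hr.trans hz)
      exact ⟨Complex.log z, by simpa [Complex.log_re] using Real.log_lt_log hr hz,
        Complex.exp_log hz0⟩
    · rintro ⟨w, hw, rfl⟩
      simpa [Complex.norm_exp] using (Real.log_lt_iff_lt_exp hr).1 hw
  rw [h]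
  exact ((convex_halfSpace_re_gt _).isPreconnected).image _ Complex.continuous_exp.continuousOn

/-- The finite points of `K`, together with an annulus around `∞` when `∞ ∈ K`. -/
def finiteNeighborhood (K : Set (OnePoint ℂ)) (r : ℝ) : Set ℂ :=
  {z | (z : OnePoint ℂ) ∈ K ∨ (OnePoint.infty ∈ K ∧ r < ‖z‖)}

theorem transGen_finiteNeighborhood {K : Set (OnePoint ℂ)} (hK : IsPreconnected K) {r δ : ℝ}
    (hr : 0 < r) (hδ : 0 < δ) {a b : ℂ} (ha : a ∈ finiteNeighborhood K r)
    (hb : b ∈ finiteNeighborhood K r) :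
    Relation.TransGen (fun x y => x ∈ finiteNeighborhood K r ∧ y ∈ finiteNeighborhood K r ∧
      ‖y - x‖ < δ) a b := by
  set s := finiteNeighborhood K r with hs
  set R : ℂ → ℂ → Prop := fun x y => x ∈ s ∧ y ∈ s ∧ ‖y - x‖ < δ with hR
  have hsymm : ∀ x y, Relation.TransGen R x y → Relation.TransGen R y x := fun x y h => by
    rw [← Relation.transGen_swap] at h
    exact Relation.TransGen.mono
      (fun u v huv => ⟨huv.2.1, huv.1, by rw [norm_sub_rev]; exact huv.2.2⟩) _ _ h
  have hann : OnePoint.infty ∈ K → ∀ x y : ℂ, r < ‖x‖ → r < ‖y‖ → Relation.TransGen R x y :=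
    fun hinf x y hx hy =>
      Relation.TransGen.mono
        (fun u v huv => ⟨Or.inr ⟨hinf, huv.1⟩, Or.inr ⟨hinf, huv.2.1⟩, huv.2.2⟩) _ _
        (transGen_of_isPreconnected (isPreconnected_norm_gt hr) hδ hx hy)
  let rep : OnePoint ℂ → ℂ → Prop := fun u x =>
    x ∈ s ∧ ((x : OnePoint ℂ) = u ∨ (u = OnePoint.infty ∧ r < ‖x‖))
  let Q : OnePoint ℂ → OnePoint ℂ → Prop := fun u v =>
    ∀ x y, rep u x → rep v y → Relation.TransGen R x y
  obtain ⟨big, hbig⟩ : ∃ z : ℂ, r < ‖z‖ := ⟨((r + 1 : ℝ) : ℂ), by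
    rw [Complex.norm_real, Real.norm_eq_abs, abs_of_pos] <;> linarith⟩
  have hQ : ∀ u ∈ K, ∀ v ∈ K, Q u v := fun u hu v hv => by
    refine hK.induction₂ Q (fun u hu => ?_) (fun u v w _ hv _ huv hvw x z hx hz => ?_)
      (fun u v _ _ huv x y hx hy => hsymm _ _ (huv y x hy hx)) hu hv
    · induction u using OnePoint.rec with
      | infty =>
        have h1 : ∀ᶠ v : OnePoint ℂ in 𝓝 OnePoint.infty,
            v = OnePoint.infty ∨ ∃ y : ℂ, v = y ∧ r < ‖y‖ := by
          rw [OnePoint.nhds_infty_eq, eventually_sup, coclosedCompact_eq_cocompact,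
            ← Metric.cobounded_eq_cocompact, ← comap_norm_atTop]
          refine ⟨?_, by simp⟩
          rw [eventually_map]
          filter_upwards [preimage_mem_comap (Ioi_mem_atTop r)] with y hy
          exact Or.inr ⟨y, rfl, hy⟩
        filter_upwards [mem_nhdsWithin_of_mem_nhds h1, self_mem_nhdsWithin] with v hv hvK x y hx hy
        have hx' : r < ‖x‖ := by
          rcases hx.2 with h | h
          · exact absurd h (OnePoint.coe_ne_infty x)
          · exact h.2
        refine hann hu x y hx' ?_
        rcases hy.2 with h | h
        · rcases hv with hv | ⟨y', hv, hy'⟩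
          · exact absurd (h.trans hv) (OnePoint.coe_ne_infty y)
          · rwa [OnePoint.coe_injective (h.trans hv)]
        · exact h.2
      | coe u =>
        have h1 : ∀ᶠ v : OnePoint ℂ in 𝓝 (u : OnePoint ℂ), ∃ y : ℂ, v = y ∧ ‖y - u‖ < δ := by
          rw [OnePoint.nhds_coe_eq, eventually_map]
          filter_upwards [Metric.ball_mem_nhds u hδ] with y hy
          exact ⟨y, rfl, by rwa [← dist_eq_norm]⟩
        filter_upwards [mem_nhdsWithin_of_mem_nhds h1, self_mem_nhdsWithin] with v hv hvK x y hx hy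
        obtain ⟨v, rfl, hvu⟩ := hv
        have hx' : x = u := by
          rcases hx.2 with h | h
          · exact OnePoint.coe_injective h
          · exact absurd h.1 (OnePoint.coe_ne_infty u)
        have hy' : y = v := by
          rcases hy.2 with h | h
          · exact OnePoint.coe_injective h
          · exact absurd h.1 (OnePoint.coe_ne_infty v)
        subst hx' hy'
        exact .single ⟨hx.1, hy.1, hvu⟩
    · obtain ⟨y, hy⟩ : ∃ y, rep v y := by
        induction v using OnePoint.rec with
        | infty => exact ⟨big, Or.inr ⟨hv, hbig⟩, Or.inr ⟨rfl, hbig⟩⟩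
        | coe v => exact ⟨v, Or.inl hv, Or.inl rfl⟩
      exact (huv x y hx hy).trans (hvw y z hy hz)
  have hrep : ∀ x ∈ s, ∃ u ∈ K, rep u x := by
    rintro x (hx | ⟨h1, h2⟩)
    · exact ⟨x, hx, Or.inl hx, Or.inl rfl⟩
    · exact ⟨_, h1, Or.inr ⟨h1, h2⟩, Or.inr ⟨rfl, h2⟩⟩
  obtain ⟨u, hu, hua⟩ := hrep a ha
  obtain ⟨v, hv, hvb⟩ := hrep b hb
  exact hQ u hu v hv a b hua hvb

theorem exists_seq_finiteNeighborhood_dense {K : Set (OnePoint ℂ)} (hK : IsConnected K) :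
    ∃ q : ℕ → ℂ, (∀ n : ℕ, q n ∈ finiteNeighborhood K (n + 1)) ∧
      ∀ w ∈ K, MapClusterPt w atTop fun n => (q n : OnePoint ℂ) := by
  rcases Set.eq_empty_or_nonempty {z : ℂ | (z : OnePoint ℂ) ∈ K} with hS | hS
  · have hsub : ∀ w ∈ K, w = OnePoint.infty := fun w hw => by
      induction w using OnePoint.rec with
      | infty => rfl
      | coe w => exact absurd hw (Set.eq_empty_iff_forall_notMem.1 hS w)
    have hinf : OnePoint.infty ∈ K := by
      obtain ⟨w, hw⟩ := hK.nonempty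
      rwa [← hsub w hw]
    have hnorm : ∀ n : ℕ, ‖((n : ℂ) + 2)‖ = n + 2 := fun n => by
      rw [← Nat.cast_ofNat, ← Nat.cast_add, Complex.norm_natCast]; simp
    refine ⟨fun n => n + 2, fun n => Or.inr ⟨hinf, ?_⟩, fun w hw => ?_⟩
    · rw [hnorm]; linarith
    · rw [hsub w hw]
      refine Tendsto.mapClusterPt (OnePoint.tendsto_coe_infty.comp ?_)
      rw [coclosedCompact_eq_cocompact, ← Metric.cobounded_eq_cocompact,
        ← tendsto_norm_atTop_iff_cobounded]
      simp only [hnorm]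
      exact tendsto_atTop_add_const_right _ _ tendsto_natCast_atTop_atTop
  · set S := {z : ℂ | (z : OnePoint ℂ) ∈ K} with hSdef
    have : Nonempty S := hS.to_subtype
    let d : ℕ → S := TopologicalSpace.denseSeq S
    refine ⟨fun n => d n.unpair.1, fun n => Or.inl (d n.unpair.1).2, fun w hw => ?_⟩
    have hfin : ∀ w : ℂ, (w : OnePoint ℂ) ∈ K →
        MapClusterPt (w : OnePoint ℂ) atTop fun n : ℕ => ((d n.unpair.1 : ℂ) : OnePoint ℂ) := by
      intro w hw
      rw [mapClusterPt_iff_frequently]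
      intro V hV
      have hV' : (fun x : S => ((x : ℂ) : OnePoint ℂ)) ⁻¹' V ∈ 𝓝 (⟨w, hw⟩ : S) :=
        (OnePoint.continuous_coe.comp continuous_subtype_val).continuousAt.preimage_mem_nhds hV
      obtain ⟨_, ⟨i, rfl⟩, hi⟩ := (TopologicalSpace.denseRange_denseSeq S).inter_nhds_nonempty hV'
      rw [frequently_atTop]
      intro a
      exact ⟨Nat.pair i a, Nat.right_le_pair i a, by simpa using hi⟩
    induction w using OnePoint.rec with
    | coe w => exact hfin w hw
    | infty =>
      obtain ⟨z, hz⟩ := hS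
      have hacc := hK.isPreconnected.preperfect_of_nontrivial
        ⟨(z : OnePoint ℂ), hz, _, hw, OnePoint.coe_ne_infty z⟩ _ hw
      rw [mapClusterPt_iff_frequently]
      intro V hV
      obtain ⟨U, hUV, hU, hwU⟩ := mem_nhds_iff.1 hV
      obtain ⟨y, ⟨hyU, hyK⟩, hy⟩ := (accPt_iff_nhds.1 hacc) U (hU.mem_nhds hwU)
      induction y using OnePoint.rec with
      | infty => exact absurd rfl hy
      | coe y =>
        exact ((mapClusterPt_iff_frequently.1 (hfin y hyK)) U (hU.mem_nhds hyU)).mono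
          fun n hn => hUV hn

theorem exists_seq_clusterSet_eq {K : Set (OnePoint ℂ)} (hKc : IsCompact K) (hK : IsConnected K) :
    ∃ x : ℕ → ℂ, Tendsto (fun n => x (n + 1) - x n) atTop (𝓝 0) ∧
      ∀ w, MapClusterPt w atTop (fun n => (x n : OnePoint ℂ)) ↔ w ∈ K := by
  obtain ⟨q, hq, hqK⟩ := exists_seq_finiteNeighborhood_dense hK
  have hanti : ∀ n : ℕ, finiteNeighborhood K ((n + 1 : ℕ) + 1) ⊆ finiteNeighborhood K (n + 1) := by
    rintro n z (hz | ⟨h1, h2⟩)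
    · exact Or.inl hz
    · refine Or.inr ⟨h1, lt_trans ?_ h2⟩
      push_cast; linarith
  obtain ⟨x, N, τ, -, hR, hN, hτ, hP⟩ := exists_seq_of_forall_transGen
    (P := fun n z => z = q n)
    (R := fun n x y => x ∈ finiteNeighborhood K (n + 1) ∧ y ∈ finiteNeighborhood K (n + 1) ∧
      ‖y - x‖ < 1 / ((n : ℝ) + 1))
    (fun n a ha => ⟨q (n + 1), rfl, transGen_finiteNeighborhood hK.isPreconnected (by positivity)
      (by positivity) (ha ▸ hq n) (hanti n (hq (n + 1)))⟩) (a₀ := q 0) rfl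
  refine ⟨x, ?_, fun w => ⟨fun hw => ?_, fun hw => ?_⟩⟩
  · exact squeeze_zero_norm (fun j => (hR j).2.2.le)
      ((tendsto_one_div_add_atTop_nhds_zero_nat (𝕜 := ℝ)).comp hN)
  · obtain ⟨U, hU, h⟩ := mapClusterPt_iff_ultrafilter.1 hw
    have hor : ∀ᶠ j in (U : Filter ℕ), (x j : OnePoint ℂ) ∈ K ∨
        (OnePoint.infty ∈ K ∧ (N j : ℝ) + 1 < ‖x j‖) := Eventually.of_forall fun j => (hR j).1
    rcases Ultrafilter.eventually_or.1 hor with hc | hc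
    · exact hKc.isClosed.mem_of_tendsto h hc
    · have h1 : Tendsto (fun j => ‖x j‖) U atTop := by
        refine tendsto_atTop_mono' _ (hc.mono fun j hj => ?_)
          ((tendsto_natCast_atTop_atTop (R := ℝ)).comp (hN.mono_left hU))
        simp only [Function.comp_apply]
        linarith [hj.2]
      have h2 : Tendsto (fun j => (x j : OnePoint ℂ)) U (𝓝 OnePoint.infty) := by
        refine OnePoint.tendsto_coe_infty.comp ?_
        rwa [coclosedCompact_eq_cocompact, ← Metric.cobounded_eq_cocompact,
          ← tendsto_norm_atTop_iff_cobounded]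
      rw [tendsto_nhds_unique h h2]
      exact hc.exists.choose_spec.1
  · refine MapClusterPt.of_comp hτ ?_
    have : (fun n => (x n : OnePoint ℂ)) ∘ τ = fun n => (q n : OnePoint ℂ) := by
      ext1 n; simp [hP n]
    rw [this]
    exact hqK w hw

section Walk

/-- One step of a walk in the plane: the position `a.1` moves by the current increment `a.2`, and
the increment changes by a relative amount of at most `ε`. The walk stays in the closed ball of
radius `ρ` around `x` and its increments are of norm at most `η`. -/
def WalkStep (ε : ℝ) (x : ℂ) (ρ η : ℝ) (a b : ℂ × ℂ) : Prop :=
  b.1 = a.1 + a.2 ∧ ‖b.2 - a.2‖ ≤ ε * ‖a.2‖ ∧ ‖b.2 - a.2‖ ≤ ε * ‖b.2‖ ∧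
    ‖a.1 - x‖ ≤ ρ ∧ a.2 ≠ 0 ∧ ‖a.2‖ ≤ η

open Relation

variable {ε ρ η : ℝ} {x : ℂ}

theorem walk_turn_iterate {μ p c : ℂ} (hμ : ‖μ‖ = 1) (hμε : ‖μ - 1‖ ≤ ε) (hc : c ≠ 0)
    (hη : ‖c‖ ≤ η) (k : ℕ) (hk : ‖p - x‖ + k * ‖c‖ ≤ ρ) :
    ∃ p', ReflTransGen (WalkStep ε x ρ η) (p, c) (p', c * μ ^ k) ∧ ‖p' - p‖ ≤ k * ‖c‖ := by
  induction k with
  | zero => exact ⟨p, by simpa using ReflTransGen.refl, by simp⟩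
  | succ k ih =>
    push_cast at hk
    obtain ⟨p', hp', hpp'⟩ := ih (by nlinarith [norm_nonneg c])
    have hn : ‖c * μ ^ k‖ = ‖c‖ := by simp [hμ]
    have hdiff : ‖c * μ ^ (k + 1) - c * μ ^ k‖ ≤ ε * ‖c‖ := by
      rw [show c * μ ^ (k + 1) - c * μ ^ k = (μ - 1) * (c * μ ^ k) by ring, norm_mul, hn]
      gcongr
    refine ⟨p' + c * μ ^ k, hp'.tail ⟨rfl, ?_, ?_, ?_, ?_, ?_⟩, ?_⟩
    · exact hdiff.trans_eq (by rw [hn])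
    · simpa only [norm_mul, norm_pow, hμ, one_pow, mul_one] using hdiff
    · calc ‖p' - x‖ ≤ ‖p' - p‖ + ‖p - x‖ := norm_sub_le_norm_sub_add_norm_sub _ _ _
        _ ≤ ρ := by linarith [norm_nonneg c]
    · rw [← norm_pos_iff, hn]; exact norm_pos_iff.2 hc
    · exact hn.trans_le hη
    · calc ‖p' + c * μ ^ k - p‖ = ‖(p' - p) + c * μ ^ k‖ := by ring_nf
        _ ≤ ‖p' - p‖ + ‖c * μ ^ k‖ := norm_add_le _ _
        _ ≤ (k + 1 : ℕ) * ‖c‖ := by rw [hn]; push_cast; linarith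

theorem walk_turn {M : ℕ} (hM : 0 < M) (hMε : Real.pi / M ≤ ε) {p c v : ℂ} (hc : c ≠ 0)
    (hv : ‖v‖ = ‖c‖) (hη : ‖c‖ ≤ η) (hρ : ‖p - x‖ + M * ‖c‖ ≤ ρ) :
    ∃ p', ReflTransGen (WalkStep ε x ρ η) (p, c) (p', v) ∧ ‖p' - p‖ ≤ M * ‖c‖ := by
  have hM' : (M : ℂ) ≠ 0 := Nat.cast_ne_zero.2 hM.ne'
  set α : ℝ := (v / c).arg / M with hα
  set μ : ℂ := Complex.exp (Complex.I * α) with hμ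
  have hμM : c * μ ^ M = v := by
    have h1 : μ ^ M = v / c := by
      have h2 := Complex.norm_mul_exp_arg_mul_I (v / c)
      rw [norm_div, hv, div_self (norm_ne_zero_iff.2 hc), Complex.ofReal_one, one_mul] at h2
      rw [← h2, hμ, ← Complex.exp_nat_mul]
      congr 1
      rw [hα]; push_cast; field_simp
    rw [h1]; field_simp
  have hμ1 : ‖μ‖ = 1 := by rw [hμ, mul_comm]; exact Complex.norm_exp_ofReal_mul_I α
  have hμε : ‖μ - 1‖ ≤ ε := by
    calc ‖μ - 1‖ ≤ ‖α‖ := Real.norm_exp_I_mul_ofReal_sub_one_le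
      _ = |(v / c).arg| / M := by
        rw [hα, Real.norm_eq_abs, abs_div, Nat.abs_cast]
      _ ≤ Real.pi / M := by gcongr; exact Complex.abs_arg_le_pi _
      _ ≤ ε := hMε
  obtain ⟨p', h1, h2⟩ := walk_turn_iterate hμ1 hμε hc hη M hρ
  exact ⟨p', hμM ▸ h1, h2⟩

theorem walk_straight {p c : ℂ} (hε : 0 ≤ ε) (hc : c ≠ 0) (hη : ‖c‖ ≤ η) (k : ℕ)
    (hk : ∀ i < k, ‖p + i * c - x‖ ≤ ρ) :
    ReflTransGen (WalkStep ε x ρ η) (p, c) (p + k * c, c) := by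
  induction k with
  | zero => simpa using ReflTransGen.refl
  | succ k ih =>
    refine (ih fun i hi => hk i (by omega)).tail ⟨by push_cast; ring, ?_, ?_, hk k (by omega),
      hc, hη⟩
    all_goals simpa using by positivity

theorem walk_to_target (hε : 0 < ε) {M : ℕ} (hM : 0 < M) (hMε : Real.pi / M ≤ ε) {p c : ℂ}
    (hc : c ≠ 0) :
    ∃ p', TransGen (WalkStep ε x (‖p - x‖ + (3 * M + 2) * ‖c‖) ‖c‖) (p, c)
      (p', -((1 + ε)⁻¹ : ℝ) * c) ∧ ‖p' - x‖ ≤ (3 * M + 2) * ‖c‖ := by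
  have hc0 : 0 < ‖c‖ := norm_pos_iff.2 hc
  have hM0 : (0 : ℝ) < M := Nat.cast_pos.2 hM
  have hMc : 0 < M * ‖c‖ := by positivity
  set ρ := ‖p - x‖ + (3 * M + 2) * ‖c‖ with hρ
  set d : ℂ := Complex.exp ((x - p).arg * Complex.I) with hd
  have hdn : ‖d‖ = 1 := Complex.norm_exp_ofReal_mul_I _
  have hdx : (‖x - p‖ : ℂ) * d = x - p := Complex.norm_mul_exp_arg_mul_I _
  set v : ℂ := ‖c‖ * d with hv
  have hvn : ‖v‖ = ‖c‖ := by rw [hv, norm_mul, hdn, Complex.norm_real]; simp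
  obtain ⟨p₁, h1, hp₁⟩ := walk_turn (x := x) (ρ := ρ) hM hMε hc hvn le_rfl
    (by rw [hρ]; linarith)
  have hline : ∀ i : ℕ, ‖p₁ + i * v - x‖ ≤ M * ‖c‖ + |i * ‖c‖ - ‖x - p‖| := fun i => by
    have : p₁ + i * v - x = (p₁ - p) + ((i * ‖c‖ - ‖x - p‖ : ℝ) : ℂ) * d := by
      push_cast
      rw [sub_mul, hdx, hv]; ring
    rw [this]
    refine (norm_add_le _ _).trans ?_
    rw [norm_mul, hdn, mul_one, Complex.norm_real, Real.norm_eq_abs]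
    linarith
  set k := ⌊‖x - p‖ / ‖c‖⌋₊ with hk
  have hk1 : k * ‖c‖ ≤ ‖x - p‖ := by
    rw [← le_div_iff₀ hc0]; exact Nat.floor_le (by positivity)
  have hk2 : ‖x - p‖ < (k + 1) * ‖c‖ := by
    rw [← div_lt_iff₀ hc0]; exact Nat.lt_floor_add_one _
  have hv0 : v ≠ 0 := norm_pos_iff.1 (hvn ▸ hc0)
  have h2 : ReflTransGen (WalkStep ε x ρ ‖c‖) (p₁, v) (p₁ + k * v, v) := by
    refine walk_straight hε.le hv0 hvn.le k fun i hi => (hline i).trans ?_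
    have hik : (i : ℝ) * ‖c‖ ≤ k * ‖c‖ := by gcongr
    rw [abs_of_nonpos (by linarith), hρ, norm_sub_rev p x]
    nlinarith [(by positivity : (0 : ℝ) ≤ i * ‖c‖)]
  have hp₂ : ‖p₁ + k * v - x‖ ≤ (M + 1) * ‖c‖ := by
    refine (hline k).trans ?_
    rw [abs_of_nonpos (by linarith)]
    linarith
  obtain ⟨p₃, h3, hp₃⟩ := walk_turn (x := x) (ρ := ρ) (η := ‖c‖) (v := -c) (p := p₁ + k * v) hM hMε
    hv0 (by rw [norm_neg, hvn]) hvn.le (by rw [hρ, hvn]; linarith [norm_nonneg (p - x)])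
  rw [hvn] at hp₃
  have hp₃x : ‖p₃ - x‖ ≤ (2 * M + 1) * ‖c‖ := by
    calc ‖p₃ - x‖ ≤ ‖p₃ - (p₁ + k * v)‖ + ‖p₁ + k * v - x‖ :=
          norm_sub_le_norm_sub_add_norm_sub _ _ _
      _ ≤ _ := by linarith
  set l : ℝ := (1 + ε)⁻¹ with hl
  have hl0 : 0 < l := by positivity
  have hl1 : l ≤ 1 := inv_le_one_of_one_le₀ (by linarith)
  have hlε : 1 - l = ε * l := by rw [hl]; field_simp; ring
  have hln : ‖-(l : ℂ) * c‖ = l * ‖c‖ := by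
    rw [norm_mul, norm_neg, Complex.norm_real, Real.norm_of_nonneg hl0.le]
  have hfac : ‖-(l : ℂ) * c - -c‖ = ε * (l * ‖c‖) := by
    rw [show -(l : ℂ) * c - -c = ((1 - l : ℝ) : ℂ) * c by push_cast; ring, norm_mul,
      Complex.norm_real, Real.norm_of_nonneg (by linarith), hlε, mul_assoc]
  have hlast : WalkStep ε x ρ ‖c‖ (p₃, -c) (p₃ - c, -(l : ℂ) * c) := by
    refine ⟨sub_eq_add_neg _ _, ?_, ?_, ?_, neg_ne_zero.2 hc, (norm_neg c).le⟩
    · simp only [hfac, norm_neg]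
      have : l * ‖c‖ ≤ ‖c‖ := by nlinarith
      gcongr
    · simp only [hfac, hln, le_refl]
    · simp only [hρ]
      linarith [norm_nonneg (p - x)]
  refine ⟨p₃ - c, TransGen.tail' ((h1.trans h2).trans h3) hlast, ?_⟩
  calc ‖p₃ - c - x‖ = ‖(p₃ - x) - c‖ := by ring_nf
    _ ≤ ‖p₃ - x‖ + ‖c‖ := norm_sub_le _ _
    _ ≤ _ := by linarith

/-- A walk with slowly varying increments tending to `0`, whose positions have the same cluster
points as a prescribed sequence, and whose increments alternate in direction infinitely often. -/
theorem exists_slow_walk (hε : 0 < ε) {u : ℂ} (hu : ‖u‖ = 1) {x : ℕ → ℂ}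
    (hx : Tendsto (fun n => x (n + 1) - x n) atTop (𝓝 0)) :
    ∃ (p c : ℕ → ℂ) (τ : ℕ → ℕ), p 0 = 0 ∧ c 0 = u ∧ (∀ n, p (n + 1) = p n + c n) ∧
      (∀ n, c n ≠ 0) ∧
      (∀ n, ‖c (n + 1) - c n‖ ≤ ε * ‖c n‖ ∧ ‖c (n + 1) - c n‖ ≤ ε * ‖c (n + 1)‖) ∧
      Tendsto c atTop (𝓝 0) ∧ Tendsto τ atTop atTop ∧
      (∀ n, ∃ r : ℝ, 0 < r ∧ c (τ n) = (-1) ^ n * r * u) ∧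
      ∀ w, MapClusterPt w atTop (fun n => (p n : OnePoint ℂ)) ↔
        MapClusterPt w atTop (fun n => (x n : OnePoint ℂ)) := by
  obtain ⟨M, hM⟩ := exists_nat_gt (Real.pi / ε)
  have hM0 : 0 < M := Nat.cast_pos.1 ((by positivity : 0 < Real.pi / ε).trans hM)
  have hMε : Real.pi / M ≤ ε := by
    rw [div_le_iff₀ (Nat.cast_pos.2 hM0)]
    rw [div_lt_iff₀ hε] at hM
    linarith
  set l : ℝ := (1 + ε)⁻¹ with hl
  have hl0 : 0 < l := by positivity
  have hl1 : l < 1 := inv_lt_one_of_one_lt₀ (by linarith)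
  set C : ℝ := 3 * M + 2 with hC
  let B : ℕ → ℝ := fun n => Nat.casesOn n ‖x 0‖ fun n => ‖x (n + 1) - x n‖ + C * l ^ n
  have hpow : Tendsto (fun n => C * l ^ n) atTop (𝓝 0) := by
    simpa using (tendsto_pow_atTop_nhds_zero_of_lt_one hl0.le hl1).const_mul C
  have hB : Tendsto B atTop (𝓝 0) := by
    rw [← tendsto_add_atTop_iff_nat 1]
    simpa using hx.norm.add hpow
  have hnorm : ∀ n : ℕ, ‖(-(l : ℂ)) ^ n * u‖ = l ^ n := fun n => by
    rw [norm_mul, hu, norm_pow, norm_neg, Complex.norm_real, Real.norm_of_nonneg hl0.le, mul_one]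
  have hne : ∀ n : ℕ, (-(l : ℂ)) ^ n * u ≠ 0 := fun n => by
    rw [← norm_pos_iff, hnorm]; positivity
  obtain ⟨s, N, τ, hs0, hR, hN, hτ, hP⟩ := exists_seq_of_forall_transGen
    (P := fun n (a : ℂ × ℂ) => ‖a.1 - x n‖ ≤ B n ∧ a.2 = (-(l : ℂ)) ^ n * u)
    (R := fun n => WalkStep ε (x n) (B n + C * l ^ n) (l ^ n))
    (by
      rintro n ⟨p, c⟩ ⟨hp, hc⟩
      simp only at hp hc
      subst hc
      obtain ⟨p', h1, h2⟩ := walk_to_target (x := x n) (p := p) hε hM0 hMε (hne n)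
      rw [hnorm] at h1 h2
      refine ⟨_, ⟨?_, ?_⟩, TransGen.mono ?_ _ _ h1⟩
      · change ‖p' - x (n + 1)‖ ≤ ‖x (n + 1) - x n‖ + C * l ^ n
        calc ‖p' - x (n + 1)‖ ≤ ‖p' - x n‖ + ‖x n - x (n + 1)‖ :=
              norm_sub_le_norm_sub_add_norm_sub _ _ _
          _ ≤ _ := by rw [norm_sub_rev (x n)]; linarith
      · simp only; ring
      · rintro a b ⟨h1, h2, h3, h4, h5⟩
        exact ⟨h1, h2, h3, h4.trans (by linarith), h5⟩)
    (a₀ := (0, u)) (by simp [B])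
  have hcτ : ∀ n, (s (τ n)).2 = (-(l : ℂ)) ^ n * u := fun n => (hP n).2
  have hclose : Tendsto (fun j => (s j).1 - x (N j)) atTop (𝓝 0) := by
    refine squeeze_zero_norm (fun j => (hR j).2.2.2.1) ?_
    simpa [Function.comp_def] using (hB.add hpow).comp hN
  have hcloseτ : Tendsto (fun n => (s (τ n)).1 - x n) atTop (𝓝 0) :=
    squeeze_zero_norm (fun n => (hP n).1) hB
  refine ⟨fun n => (s n).1, fun n => (s n).2, τ, by simp [hs0], by simp [hs0],
    fun n => (hR n).1, fun n => (hR n).2.2.2.2.1, fun n => ⟨(hR n).2.1, (hR n).2.2.1⟩, ?_, hτ,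
    fun n => ⟨l ^ n, by positivity, ?_⟩, fun w => ⟨fun hw => ?_, fun hw => ?_⟩⟩
  · exact squeeze_zero_norm (fun j => (hR j).2.2.2.2.2)
      ((tendsto_pow_atTop_nhds_zero_of_lt_one hl0.le hl1).comp hN)
  · simp only [hcτ]
    rw [neg_pow]; push_cast; ring
  · have h1 : MapClusterPt w atTop fun j => (x (N j) : OnePoint ℂ) :=
      mapClusterPt_coe_of_sub_tendsto_zero (by simpa using hclose.neg) hw
    exact MapClusterPt.of_comp (u := fun n => (x n : OnePoint ℂ)) hN h1
  · have h1 : MapClusterPt w atTop fun n => ((s (τ n)).1 : OnePoint ℂ) :=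
      mapClusterPt_coe_of_sub_tendsto_zero hcloseτ hw
    exact MapClusterPt.of_comp (u := fun n => ((s n).1 : OnePoint ℂ)) hτ h1

end Walk

theorem hasSum_geometric_natAbs_sub {r : ℝ} (h0 : 0 ≤ r) (h1 : r < 1) (m : ℤ) :
    HasSum (fun n : ℤ => r ^ (n - m).natAbs) ((1 + r) / (1 - r)) := by
  have h : HasSum (fun n : ℤ => r ^ n.natAbs) ((1 - r)⁻¹ + (1 - r)⁻¹ * r) := by
    refine HasSum.of_nat_of_neg_add_one (by simpa using hasSum_geometric_of_lt_one h0 h1) ?_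
    have := (hasSum_geometric_of_lt_one h0 h1).mul_right r
    refine this.congr_fun ?_
    intro n
    rw [Int.natAbs_neg, ← pow_succ, ← Nat.cast_succ, Int.natAbs_natCast]
  rw [show (1 - r)⁻¹ + (1 - r)⁻¹ * r = (1 + r) / (1 - r) by ring] at h
  simpa only [Function.comp_def, Equiv.subRight_apply] using (Equiv.subRight m).hasSum_iff.2 h

theorem norm_sub_le_of_slow {ε : ℝ} (hε : 0 ≤ ε) {a : ℕ → ℂ}
    (ha : ∀ n, ‖a (n + 1) - a n‖ ≤ ε * ‖a n‖) (n : ℕ) :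
    ‖a n - a 0‖ ≤ ((1 + ε) ^ n - 1) * ‖a 0‖ := by
  induction n with
  | zero => simp
  | succ n ih =>
    have h1 : ‖a n‖ ≤ (1 + ε) ^ n * ‖a 0‖ := by
      calc ‖a n‖ = ‖(a n - a 0) + a 0‖ := by rw [sub_add_cancel]
        _ ≤ ‖a n - a 0‖ + ‖a 0‖ := norm_add_le _ _
        _ ≤ _ := by linarith
    calc ‖a (n + 1) - a 0‖ ≤ ‖a (n + 1) - a n‖ + ‖a n - a 0‖ :=
          norm_sub_le_norm_sub_add_norm_sub _ _ _
      _ ≤ ε * ((1 + ε) ^ n * ‖a 0‖) + ((1 + ε) ^ n - 1) * ‖a 0‖ :=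
          add_le_add ((ha n).trans (by gcongr)) ih
      _ = _ := by ring

theorem norm_sub_le_of_slow_int {ε : ℝ} (hε : 0 ≤ ε) {c : ℤ → ℂ}
    (hc : ∀ n, ‖c (n + 1) - c n‖ ≤ ε * ‖c n‖ ∧ ‖c (n + 1) - c n‖ ≤ ε * ‖c (n + 1)‖) (n m : ℤ) :
    ‖c n - c m‖ ≤ ((1 + ε) ^ (n - m).natAbs - 1) * ‖c m‖ := by
  rcases le_total m n with h | h
  · have := norm_sub_le_of_slow hε (a := fun k => c (m + k))
      (fun k => by simpa [add_assoc] using (hc (m + k)).1) (n - m).natAbs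
    have h2 : m + ((n - m).natAbs : ℤ) = n := by omega
    simpa only [h2, Nat.cast_zero, add_zero] using this
  · have := norm_sub_le_of_slow hε (a := fun k => c (m - k))
      (fun k => by
        have h3 := (hc (m - (k + 1 : ℕ))).2
        have h4 : m - ((k + 1 : ℕ) : ℤ) + 1 = m - k := by push_cast; ring
        rw [h4, norm_sub_rev] at h3
        exact h3) (n - m).natAbs
    have h2 : m - ((n - m).natAbs : ℤ) = n := by omega
    simpa only [h2, Nat.cast_zero, sub_zero] using this

theorem norm_le_of_slow_int {ε : ℝ} (hε : 0 ≤ ε) {c : ℤ → ℂ}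
    (hc : ∀ n, ‖c (n + 1) - c n‖ ≤ ε * ‖c n‖ ∧ ‖c (n + 1) - c n‖ ≤ ε * ‖c (n + 1)‖) (n m : ℤ) :
    ‖c n‖ ≤ (1 + ε) ^ (n - m).natAbs * ‖c m‖ := by
  have := norm_sub_le_of_slow_int hε hc n m
  calc ‖c n‖ = ‖(c n - c m) + c m‖ := by rw [sub_add_cancel]
    _ ≤ ‖c n - c m‖ + ‖c m‖ := norm_add_le _ _
    _ ≤ _ := by linarith

section HalfPlane

variable {q : ℂ} {s : ℝ}

theorem norm_le_norm_add_ofReal (hq : 0 ≤ q.re) (hs : 0 ≤ s) : ‖q‖ ≤ ‖q + s‖ := by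
  rw [← sq_le_sq₀ (norm_nonneg _) (norm_nonneg _), ← Complex.normSq_eq_norm_sq,
    ← Complex.normSq_eq_norm_sq, Complex.normSq_apply, Complex.normSq_apply]
  simp only [Complex.add_re, Complex.add_im, Complex.ofReal_re, Complex.ofReal_im]
  nlinarith [mul_nonneg hq hs]

theorem le_norm_add_ofReal (hq : 0 ≤ q.re) : s ≤ ‖q + s‖ := by
  refine le_trans ?_ (Complex.re_le_norm _)
  simpa using hq

theorem re_mul_div_add_sq (q : ℂ) (s : ℝ) :
    (q * s / (q + s) ^ 2).re =
      s * ((‖q‖ ^ 2 + s ^ 2) * q.re + 2 * s * ‖q‖ ^ 2) / ‖q + s‖ ^ 4 := by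
  have h4 : ‖q + s‖ ^ 4 = Complex.normSq ((q + s) ^ 2) := by
    rw [Complex.normSq_eq_norm_sq, norm_pow]; ring
  rw [Complex.div_re, ← add_div, h4, ← Complex.normSq_eq_norm_sq, Complex.normSq_apply]
  congr 1
  simp [pow_two, Complex.normSq_apply]
  ring

theorem re_mul_div_add_sq_nonneg (hq : 0 ≤ q.re) (hs : 0 ≤ s) :
    0 ≤ (q * s / (q + s) ^ 2).re := by
  rw [re_mul_div_add_sq]
  positivity

theorem le_re_mul_div_add_sq (hq : 0 ≤ q.re) (hs : 0 < s) (h1 : s ≤ ‖q‖) (h2 : ‖q‖ ≤ 2 * s) :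
    2 / 25 ≤ (q * s / (q + s) ^ 2).re := by
  have hqs : ‖q + s‖ ≤ ‖q‖ + s :=
    (norm_add_le _ _).trans_eq (by rw [Complex.norm_real, Real.norm_of_nonneg hs.le])
  have hpos : 0 < ‖q + s‖ := hs.trans_le (le_norm_add_ofReal hq)
  have h3 : ‖q + s‖ ^ 2 ≤ 5 * (s * ‖q‖) := by
    calc ‖q + s‖ ^ 2 ≤ (‖q‖ + s) ^ 2 := by gcongr
      _ ≤ 5 * (s * ‖q‖) := by nlinarith [mul_nonneg (sub_nonneg.2 h1) (sub_nonneg.2 h2)]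
  have h4 : ‖q + s‖ ^ 4 ≤ 25 * (s * ‖q‖) ^ 2 := by
    calc ‖q + s‖ ^ 4 = (‖q + s‖ ^ 2) ^ 2 := by ring
      _ ≤ (5 * (s * ‖q‖)) ^ 2 := by gcongr
      _ = _ := by ring
  rw [re_mul_div_add_sq, div_le_div_iff₀ (by norm_num) (by positivity)]
  have h5 : 0 ≤ s * ((‖q‖ ^ 2 + s ^ 2) * q.re) := by positivity
  nlinarith

/-- The rational function with pole `-2 ^ n` whose sum over `n`, weighted by increments, smooths a
step function on the right half-plane in the logarithmic scale. -/
noncomputable def smoothStep (m n : ℤ) (q : ℂ) : ℂ :=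
  q / (q + ((2 : ℝ) ^ n : ℝ)) - if n < m then 1 else 0

theorem add_zpow_ne_zero (hq : 0 < q.re) (n : ℤ) : q + ((2 : ℝ) ^ n : ℝ) ≠ 0 := by
  have : (0 : ℝ) < 2 ^ n := by positivity
  exact norm_pos_iff.1 (this.trans_le (le_norm_add_ofReal hq.le))

theorem two_zpow_sub (m n : ℤ) : ((2 : ℝ) ^ n) / 2 ^ m = 2 ^ (n - m) := by
  rw [zpow_sub₀ two_ne_zero]

theorem half_pow_natAbs_of_le {m n : ℤ} (h : m ≤ n) :
    ((1 : ℝ) / 2) ^ (n - m).natAbs = 2 ^ m / 2 ^ n := by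
  rw [two_zpow_sub, ← zpow_natCast, one_div, inv_zpow']
  congr 1; omega

theorem half_pow_natAbs_of_ge {m n : ℤ} (h : n ≤ m) :
    ((1 : ℝ) / 2) ^ (n - m).natAbs = 2 ^ n / 2 ^ m := by
  rw [two_zpow_sub, ← zpow_natCast, one_div, inv_zpow']
  congr 1; omega

theorem norm_smoothStep_le (hq : 0 < q.re) {R : ℝ} {m : ℤ} (h1 : ‖q‖ ≤ R * 2 ^ m)
    (h2 : 2 ^ m ≤ R * ‖q‖) (n : ℤ) :
    ‖smoothStep m n q‖ ≤ R * (1 / 2) ^ (n - m).natAbs := by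
  have hn : (0 : ℝ) < 2 ^ n := by positivity
  have hm : (0 : ℝ) < 2 ^ m := by positivity
  have hq0 : 0 < ‖q‖ := hq.trans_le (Complex.re_le_norm q)
  have hden := add_zpow_ne_zero hq n
  unfold smoothStep
  rcases lt_or_ge n m with h | h
  · rw [if_pos h, half_pow_natAbs_of_ge h.le, div_sub_one hden, sub_add_cancel_left, norm_div,
      norm_neg, Complex.norm_real, Real.norm_of_nonneg hn.le]
    calc (2 : ℝ) ^ n / ‖q + ((2 : ℝ) ^ n : ℝ)‖ ≤ 2 ^ n / ‖q‖ := by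
          gcongr; exact norm_le_norm_add_ofReal hq.le hn.le
      _ ≤ R * (2 ^ n / 2 ^ m) := by
          rw [← mul_div_assoc, div_le_div_iff₀ hq0 hm]; nlinarith
  · rw [if_neg (not_lt.2 h), half_pow_natAbs_of_le h, sub_zero, norm_div]
    calc ‖q‖ / ‖q + ((2 : ℝ) ^ n : ℝ)‖ ≤ R * 2 ^ m / 2 ^ n := by
          gcongr
          · exact (norm_nonneg q).trans h1
          · exact le_norm_add_ofReal hq.le
      _ = _ := by ring

theorem norm_mul_div_add_sq_le (hq : 0 < q.re) {R : ℝ} {m : ℤ} (h1 : ‖q‖ ≤ R * 2 ^ m)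
    (h2 : 2 ^ m ≤ R * ‖q‖) (n : ℤ) :
    ‖q * ((2 : ℝ) ^ n : ℝ) / (q + ((2 : ℝ) ^ n : ℝ)) ^ 2‖ ≤ R * (1 / 2) ^ (n - m).natAbs := by
  have hn : (0 : ℝ) < 2 ^ n := by positivity
  have hm : (0 : ℝ) < 2 ^ m := by positivity
  have hq0 : 0 < ‖q‖ := hq.trans_le (Complex.re_le_norm q)
  have hA := norm_le_norm_add_ofReal hq.le hn.le
  have hB := le_norm_add_ofReal (s := 2 ^ n) hq.le
  rw [norm_div, norm_mul, norm_pow, Complex.norm_real, Real.norm_of_nonneg hn.le]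
  rcases le_total n m with h | h
  · rw [half_pow_natAbs_of_ge h]
    calc ‖q‖ * 2 ^ n / ‖q + ((2 : ℝ) ^ n : ℝ)‖ ^ 2 ≤ ‖q‖ * 2 ^ n / ‖q‖ ^ 2 := by gcongr
      _ = 2 ^ n / ‖q‖ := by field_simp
      _ ≤ R * (2 ^ n / 2 ^ m) := by
          rw [← mul_div_assoc, div_le_div_iff₀ hq0 hm]; nlinarith
  · rw [half_pow_natAbs_of_le h]
    calc ‖q‖ * 2 ^ n / ‖q + ((2 : ℝ) ^ n : ℝ)‖ ^ 2 ≤ ‖q‖ * 2 ^ n / (2 ^ n) ^ 2 := by gcongr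
      _ = ‖q‖ / 2 ^ n := by field_simp
      _ ≤ R * 2 ^ m / 2 ^ n := by gcongr
      _ = _ := by ring

end HalfPlane

section Series

variable {ε : ℝ} {c : ℤ → ℂ} {q : ℂ}

theorem norm_mul_le_of_slow (hε : 0 ≤ ε)
    (hc : ∀ n, ‖c (n + 1) - c n‖ ≤ ε * ‖c n‖ ∧ ‖c (n + 1) - c n‖ ≤ ε * ‖c (n + 1)‖)
    {R : ℝ} {m n : ℤ} {z : ℂ} (hz : ‖z‖ ≤ R * (1 / 2) ^ (n - m).natAbs) :
    ‖c n * z‖ ≤ ‖c m‖ * R * ((1 + ε) / 2) ^ (n - m).natAbs := by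
  rw [norm_mul]
  calc ‖c n‖ * ‖z‖ ≤ ((1 + ε) ^ (n - m).natAbs * ‖c m‖) * (R * (1 / 2) ^ (n - m).natAbs) :=
        mul_le_mul (norm_le_of_slow_int hε hc n m) hz (norm_nonneg _) (by positivity)
    _ = _ := by rw [div_eq_mul_one_div (1 + ε) 2, mul_pow]; ring

theorem hasSum_slow_bound (hε : 0 ≤ ε) (hε1 : ε < 1) (A : ℝ) (m : ℤ) :
    HasSum (fun n : ℤ => A * ((1 + ε) / 2) ^ (n - m).natAbs) (A * ((3 + ε) / (1 - ε))) := by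
  have h := hasSum_geometric_natAbs_sub (r := (1 + ε) / 2) (by positivity) (by linarith) m
  have e : (1 + (1 + ε) / 2) / (1 - (1 + ε) / 2) = (3 + ε) / (1 - ε) := by
    rw [div_eq_div_iff (by linarith) (by linarith)]; ring
  exact e ▸ h.mul_left A

/-- The interpolating series of a bi-infinite sequence of increments. -/
noncomputable def interpSeries (c : ℤ → ℂ) (q : ℂ) : ℂ := ∑' n, c n * smoothStep 0 n q

theorem summable_mul_smoothStep (hε : 0 ≤ ε) (hε1 : ε < 1)
    (hc : ∀ n, ‖c (n + 1) - c n‖ ≤ ε * ‖c n‖ ∧ ‖c (n + 1) - c n‖ ≤ ε * ‖c (n + 1)‖)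
    (hq : 0 < q.re) (m : ℤ) : Summable fun n => c n * smoothStep m n q := by
  have hq0 : 0 < ‖q‖ := hq.trans_le (Complex.re_le_norm q)
  have hm : (0 : ℝ) < 2 ^ m := by positivity
  refine .of_norm_bounded
    (hasSum_slow_bound hε hε1 (‖c m‖ * (‖q‖ / 2 ^ m + 2 ^ m / ‖q‖)) m).summable fun n => ?_
  refine norm_mul_le_of_slow hε hc (norm_smoothStep_le hq ?_ ?_ n)
  · rw [add_mul, div_mul_cancel₀ _ hm.ne']
    exact le_add_of_nonneg_right (by positivity)
  · rw [add_mul, div_mul_cancel₀ _ hq0.ne']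
    exact le_add_of_nonneg_left (by positivity)

theorem interpSeries_eq_add_tsum (hε : 0 ≤ ε) (hε1 : ε < 1)
    (hc : ∀ n, ‖c (n + 1) - c n‖ ≤ ε * ‖c n‖ ∧ ‖c (n + 1) - c n‖ ≤ ε * ‖c (n + 1)‖)
    {p : ℤ → ℂ} (hp0 : p 0 = 0) (hp : ∀ n, p (n + 1) = p n + c n)
    (hq : 0 < q.re) (m : ℤ) :
    interpSeries c q = p m + ∑' n, c n * smoothStep m n q := by
  have step : ∀ m, ∑' n, c n * smoothStep m n q = c m + ∑' n, c n * smoothStep (m + 1) n q := by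
    intro m
    have h1 := (summable_mul_smoothStep hε hε1 hc hq m).hasSum.sub
      (summable_mul_smoothStep hε hε1 hc hq (m + 1)).hasSum
    have h2 : HasSum (fun n => c n * smoothStep m n q - c n * smoothStep (m + 1) n q) (c m) := by
      convert hasSum_single m ?_ using 1
      · simp only [smoothStep, lt_irrefl, if_false, lt_add_one, if_true]; ring
      · intro n hn
        have : n < m ↔ n < m + 1 := by omega
        simp [smoothStep, this]
    rw [h2.unique h1]; ring
  induction m using Int.induction_on with
  | zero => simp [interpSeries, hp0]
  | succ k ih => rw [ih, step, hp]; ring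
  | pred k ih =>
    have h := step (-k - 1)
    have h' := hp (-k - 1)
    rw [sub_add_cancel] at h h'
    rw [ih, h, h']; ring

theorem norm_interpSeries_sub_le (hε : 0 ≤ ε) (hε1 : ε < 1)
    (hc : ∀ n, ‖c (n + 1) - c n‖ ≤ ε * ‖c n‖ ∧ ‖c (n + 1) - c n‖ ≤ ε * ‖c (n + 1)‖)
    {p : ℤ → ℂ} (hp0 : p 0 = 0) (hp : ∀ n, p (n + 1) = p n + c n)
    (hq : 0 < q.re) {m : ℤ} (h1 : 2 ^ m ≤ ‖q‖) (h2 : ‖q‖ ≤ 2 * 2 ^ m) :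
    ‖interpSeries c q - p m‖ ≤ ‖c m‖ * 2 * ((3 + ε) / (1 - ε)) := by
  rw [interpSeries_eq_add_tsum hε hε1 hc hp0 hp hq m, add_sub_cancel_left]
  exact tsum_of_norm_bounded (hasSum_slow_bound hε hε1 _ m) fun n =>
    norm_mul_le_of_slow hε hc
      (norm_smoothStep_le hq h2 (h1.trans (by linarith [norm_nonneg q])) n)

theorem hasDerivAt_smoothStep (hq : 0 < q.re) (m n : ℤ) :
    HasDerivAt (smoothStep m n) (((2 : ℝ) ^ n : ℝ) / (q + ((2 : ℝ) ^ n : ℝ)) ^ 2) q := by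
  have h := ((hasDerivAt_id q).div ((hasDerivAt_id q).add_const (((2 : ℝ) ^ n : ℝ) : ℂ))
    (add_zpow_ne_zero hq n)).sub_const (if n < m then 1 else 0)
  refine h.congr_deriv ?_
  simp

theorem interpSeries_differentiableAt_and_hasSum_deriv (hε : 0 ≤ ε) (hε1 : ε < 1)
    (hc : ∀ n, ‖c (n + 1) - c n‖ ≤ ε * ‖c n‖ ∧ ‖c (n + 1) - c n‖ ≤ ε * ‖c (n + 1)‖)
    (hq : 0 < q.re) :
    DifferentiableAt ℂ (interpSeries c) q ∧
      HasSum (fun n : ℤ => c n * (((2 : ℝ) ^ n : ℝ) / (q + ((2 : ℝ) ^ n : ℝ)) ^ 2))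
        (deriv (interpSeries c) q) := by
  have hq0 : 0 < ‖q‖ := hq.trans_le (Complex.re_le_norm q)
  set R := ‖q‖ + 1 / ‖q‖ + 1 with hR
  let U : Set ℂ := {w | 0 < w.re ∧ ‖w‖ < R ∧ 1 < R * ‖w‖}
  have hU : IsOpen U :=
    (isOpen_lt continuous_const Complex.continuous_re).inter
      ((isOpen_lt continuous_norm continuous_const).inter
        (isOpen_lt continuous_const (continuous_const.mul continuous_norm)))
  have hqU : q ∈ U := by
    refine ⟨hq, by rw [hR]; linarith [one_div_pos.2 hq0], ?_⟩
    rw [hR, add_mul, add_mul, one_div, inv_mul_cancel₀ hq0.ne']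
    nlinarith
  have hbd : ∀ (n : ℤ), ∀ w ∈ U, ‖c n * smoothStep 0 n w‖ ≤
      ‖c 0‖ * R * ((1 + ε) / 2) ^ (n - 0).natAbs := fun n w hw =>
    norm_mul_le_of_slow hε hc (norm_smoothStep_le hw.1 (by simpa using hw.2.1.le)
      (by simpa using hw.2.2.le) n)
  have hd : ∀ n : ℤ, DifferentiableOn ℂ (fun w => c n * smoothStep 0 n w) U := fun n w hw =>
    ((hasDerivAt_smoothStep hw.1 0 n).differentiableAt.const_mul _).differentiableWithinAt
  have hs := (hasSum_slow_bound hε hε1 (‖c 0‖ * R) 0).summable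
  refine ⟨(Complex.differentiableOn_tsum_of_summable_norm hs hd hU hbd).differentiableAt
    (hU.mem_nhds hqU), ?_⟩
  have h := Complex.hasSum_deriv_of_summable_norm hs hd hU hbd hqU
  refine h.congr_fun ?_
  intro n
  exact (((hasDerivAt_smoothStep hq 0 n).const_mul (c n)).deriv).symm

/-- The logarithmic derivative of the interpolating series, measured in units of the increment at
the relevant scale, stays in a fixed compact part of the right half-plane. -/
theorem exists_deriv_interpSeries_eq
    (hc : ∀ n, ‖c (n + 1) - c n‖ ≤ 1 / 400 * ‖c n‖ ∧
      ‖c (n + 1) - c n‖ ≤ 1 / 400 * ‖c (n + 1)‖)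
    (hq : 0 < q.re) {m : ℤ} (hcm : c m ≠ 0) (h1 : 2 ^ m ≤ ‖q‖) (h2 : ‖q‖ ≤ 2 * 2 ^ m) :
    ∃ v : ℂ, deriv (interpSeries c) q = c m * v / q ∧ 1 / 25 ≤ v.re ∧ ‖v‖ ≤ 8 := by
  have hq0 : q ≠ 0 := by rintro rfl; simp at hq
  have hcm0 : 0 < ‖c m‖ := norm_pos_iff.2 hcm
  set κ : ℤ → ℂ := fun n => q * ((2 : ℝ) ^ n : ℝ) / (q + ((2 : ℝ) ^ n : ℝ)) ^ 2 with hκ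
  have hκn : ∀ n, ‖κ n‖ ≤ 2 * (1 / 2) ^ (n - m).natAbs := fun n =>
    norm_mul_div_add_sq_le hq h2 (h1.trans (by linarith [norm_nonneg q])) n
  set v := q * deriv (interpSeries c) q / c m with hv
  have hsum : HasSum (fun n => c n / c m * κ n) v := by
    have h := ((interpSeries_differentiableAt_and_hasSum_deriv (by norm_num) (by norm_num) hc
      hq).2.mul_left q).div_const (c m)
    refine h.congr_fun ?_
    intro n
    simp only [hκ]; ring
  refine ⟨v, by rw [hv]; field_simp, ?_, ?_⟩
  · have hB : HasSum (fun n : ℤ => (2 * (((1 + 1 / 400) / 2) ^ (n - m).natAbs) -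
        2 * (((1 + 0) / 2) ^ (n - m).natAbs)) : ℤ → ℝ) (8 / 399) := by
      have h := (hasSum_slow_bound (ε := 1 / 400) (by norm_num) (by norm_num) 2 m).sub
        (hasSum_slow_bound (ε := 0) (by norm_num) (by norm_num) 2 m)
      rwa [show (2 * ((3 + 1 / 400) / (1 - 1 / 400)) - 2 * ((3 + 0) / (1 - 0)) : ℝ) = 8 / 399 by
        norm_num] at h
    have hlow : ∀ n, (if n = m then (2 / 25 : ℝ) else 0) -
        (2 * (((1 + 1 / 400) / 2) ^ (n - m).natAbs) - 2 * (((1 + 0) / 2) ^ (n - m).natAbs)) ≤ (c n / c m * κ n).re := by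
      intro n
      have e1 : (if n = m then (2 / 25 : ℝ) else 0) ≤ (κ n).re := by
        split_ifs with hn
        · subst hn
          exact le_re_mul_div_add_sq hq.le (by positivity) h1 h2
        · exact re_mul_div_add_sq_nonneg hq.le (by positivity)
      have e2 : ‖(c n / c m - 1) * κ n‖ ≤ 2 * (((1 + 1 / 400) / 2) ^ (n - m).natAbs) -
        2 * (((1 + 0) / 2) ^ (n - m).natAbs) := by
        rw [norm_mul, div_sub_one hcm, norm_div]
        have e3 : ‖c n - c m‖ / ‖c m‖ ≤ (1 + 1 / 400) ^ (n - m).natAbs - 1 := by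
          rw [div_le_iff₀ hcm0]
          exact norm_sub_le_of_slow_int (by norm_num) hc n m
        calc _ ≤ ((1 + 1 / 400) ^ (n - m).natAbs - 1) * (2 * (1 / 2) ^ (n - m).natAbs) :=
              mul_le_mul e3 (hκn n) (norm_nonneg _) ((by positivity : (0 : ℝ) ≤ _).trans e3)
          _ = _ := by
            rw [div_eq_mul_one_div (1 + 1 / 400 : ℝ) 2, mul_pow]; ring
      have e4 := (abs_le.1 ((Complex.abs_re_le_norm _).trans e2)).1
      have e5 : (c n / c m * κ n).re = (κ n).re + ((c n / c m - 1) * κ n).re := by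
        rw [← Complex.add_re]; congr 1; ring
      linarith
    have := hasSum_le hlow ((hasSum_ite_eq m (2 / 25 : ℝ)).sub hB) (Complex.hasSum_re hsum)
    linarith
  · have hb := hasSum_slow_bound (ε := 1 / 400) (by norm_num) (by norm_num) 2 m
    rw [← hsum.tsum_eq]
    refine (tsum_of_norm_bounded hb fun n => ?_).trans (by norm_num)
    rw [div_mul_eq_mul_div, norm_div, div_le_iff₀ hcm0]
    refine (norm_mul_le_of_slow (by norm_num) hc (hκn n)).trans_eq (by ring)

end Series

section ClusterSets

variable {D : Set ℂ} {b : Filter ℝ} {F : Filter ℤ} {G : ℂ → ℂ} {p c : ℤ → ℂ} {N : ℂ → ℤ}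
  {t : ℤ → ℝ} {A : ℝ}

theorem mapClusterPt_of_norm_sub_le
    (hN : Tendsto N (comap Complex.re b ⊓ 𝓟 D) F)
    (hG : ∀ z ∈ D, ‖G z - p (N z)‖ ≤ A * ‖c (N z)‖) (hc : Tendsto c F (𝓝 0)) {w : OnePoint ℂ}
    (hw : MapClusterPt w (comap Complex.re b ⊓ 𝓟 D) fun z => (G z : OnePoint ℂ)) :
    MapClusterPt w F fun n => (p n : OnePoint ℂ) := by
  refine MapClusterPt.of_comp hN (mapClusterPt_coe_of_sub_tendsto_zero ?_ hw)
  refine squeeze_zero_norm' (a := fun z => A * ‖c (N z)‖) ?_ ?_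
  · filter_upwards [mem_inf_of_right (mem_principal_self D)] with z hz
    rw [norm_sub_rev]
    exact hG z hz
  · simpa using ((hc.comp hN).norm).const_mul A

theorem mapClusterPt_real_of_norm_sub_le (hD : ∀ x : ℝ, (x : ℂ) ∈ D)
    (hG : ∀ z ∈ D, ‖G z - p (N z)‖ ≤ A * ‖c (N z)‖) (hc : Tendsto c F (𝓝 0))
    (ht : Tendsto t F b) (hNt : ∀ m, N (t m) = m) {w : OnePoint ℂ}
    (hw : MapClusterPt w F fun n => (p n : OnePoint ℂ)) :
    MapClusterPt w b fun x : ℝ => (G x : OnePoint ℂ) := by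
  refine MapClusterPt.of_comp ht (mapClusterPt_coe_of_sub_tendsto_zero ?_ hw)
  refine squeeze_zero_norm (a := fun m => A * ‖c m‖) (fun m => ?_) ?_
  · simpa only [hNt] using hG _ (hD (t m))
  · simpa using hc.norm.const_mul A

/-- If `G` follows a walk `p` closely, then the cluster set of `G` along the real line, the cluster
set of `G` along the domain and the cluster set of the walk agree. -/
theorem clusterSet_eq_of_norm_sub_le [b.IsCountablyGenerated] (hD : ∀ x : ℝ, (x : ℂ) ∈ D)
    (hN : Tendsto N (comap Complex.re b ⊓ 𝓟 D) F)
    (hG : ∀ z ∈ D, ‖G z - p (N z)‖ ≤ A * ‖c (N z)‖) (hc : Tendsto c F (𝓝 0))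
    (ht : Tendsto t F b) (hNt : ∀ m, N (t m) = m) {K : Set (OnePoint ℂ)}
    (hK : ∀ w, MapClusterPt w F (fun n => (p n : OnePoint ℂ)) ↔ w ∈ K) :
    {w : OnePoint ℂ | MapClusterPt w b fun x : ℝ => ((G x : ℂ) : OnePoint ℂ)} = K ∧
      ∀ w : OnePoint ℂ, w ∈ K ↔ ∃ z : ℕ → ℂ, (∀ n, z n ∈ D) ∧
        Tendsto (fun n => (z n).re) atTop b ∧
        Tendsto (fun n => ((G (z n) : ℂ) : OnePoint ℂ)) atTop (𝓝 w) := by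
  have hmem : ∀ w, (∃ z : ℕ → ℂ, (∀ n, z n ∈ D) ∧ Tendsto (fun n => (z n).re) atTop b ∧
      Tendsto (fun n => ((G (z n) : ℂ) : OnePoint ℂ)) atTop (𝓝 w)) → w ∈ K := by
    rintro w ⟨z, hzD, hz, hw⟩
    refine (hK w).1 (mapClusterPt_of_norm_sub_le hN hG hc (MapClusterPt.of_comp (φ := z) ?_
      hw.mapClusterPt))
    exact tendsto_inf.2 ⟨tendsto_comap_iff.2 hz, tendsto_principal.2 (.of_forall hzD)⟩
  have hseq : ∀ w, MapClusterPt w b (fun x : ℝ => ((G x : ℂ) : OnePoint ℂ)) →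
      ∃ z : ℕ → ℂ, (∀ n, z n ∈ D) ∧ Tendsto (fun n => (z n).re) atTop b ∧
        Tendsto (fun n => ((G (z n) : ℂ) : OnePoint ℂ)) atTop (𝓝 w) := by
    intro w hw
    obtain ⟨ψ, h1, h2⟩ := hw.exists_seq_tendsto
    exact ⟨fun n => ψ n, fun n => hD _, by simpa using h2, h1⟩
  have hreal : ∀ w ∈ K, MapClusterPt w b fun x : ℝ => ((G x : ℂ) : OnePoint ℂ) := fun w hw =>
    mapClusterPt_real_of_norm_sub_le hD hG hc ht hNt ((hK w).2 hw)
  exact ⟨Set.ext fun w => ⟨fun hw => hmem w (hseq w hw), hreal w⟩,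
    fun w => ⟨fun hw => hseq w (hreal w hw), hmem w⟩⟩

theorem not_tendsto_of_alternating {g : ℝ → ℂ} {s : ℕ → ℝ} (hs : Tendsto s atTop b) {δ : ℝ}
    (hδ : 0 < δ) (hg : ∀ n, δ ≤ (-1) ^ n * (g (s n)).re) :
    ¬ ∃ a : ℂ, Tendsto g b (𝓝 a) := by
  rintro ⟨a, ha⟩
  have h : Tendsto (fun n => (g (s n)).re) atTop (𝓝 a.re) :=
    (Complex.continuous_re.tendsto a).comp (ha.comp hs)
  have h0 : Tendsto (fun n : ℕ => 2 * n) atTop atTop := tendsto_id.const_mul_atTop' two_pos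
  have h1 : δ ≤ a.re := ge_of_tendsto' (h.comp h0) fun n => by
    simpa [pow_mul] using hg (2 * n)
  have h2 : a.re ≤ -δ := le_of_tendsto' (h.comp ((tendsto_add_atTop_nat 1).comp h0)) fun n => by
    have := hg (2 * n + 1)
    rw [pow_succ, pow_mul, neg_one_sq, one_pow] at this
    simp only [Function.comp_apply]
    linarith
  linarith

end ClusterSets

section SlitPlane

/-- The branch of `√(1 + z ^ 2)` with positive real part on the doubly slit plane. -/
noncomputable def sqrtOneAddSq (z : ℂ) : ℂ := Complex.exp (Complex.log (1 + z ^ 2) / 2)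

/-- The conformal map `z + √(1 + z ^ 2)` of the doubly slit plane onto the right half-plane. -/
noncomputable def toHalfPlane (z : ℂ) : ℂ := z + sqrtOneAddSq z

variable {z : ℂ}

theorem one_add_sq_mem_slitPlane (h1 : ¬ (z.re = 0 ∧ 1 ≤ z.im)) (h2 : ¬ (z.re = 0 ∧ z.im ≤ -1)) :
    1 + z ^ 2 ∈ Complex.slitPlane := by
  rw [Complex.mem_slitPlane_iff]
  simp only [pow_two, Complex.add_re, Complex.one_re, Complex.mul_re, Complex.add_im,
    Complex.one_im, Complex.mul_im]
  by_cases hx : z.re = 0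
  · left
    have h3 : z.im < 1 := lt_of_not_ge fun h => h1 ⟨hx, h⟩
    have h4 : -1 < z.im := lt_of_not_ge fun h => h2 ⟨hx, h⟩
    rw [hx]; nlinarith
  · by_cases hy : z.im = 0
    · left; rw [hy]; nlinarith [mul_self_nonneg z.re]
    · right
      have : z.re * z.im ≠ 0 := mul_ne_zero hx hy
      intro h
      apply this
      linarith

theorem sqrtOneAddSq_sq (hz : 1 + z ^ 2 ∈ Complex.slitPlane) : sqrtOneAddSq z ^ 2 = 1 + z ^ 2 := by
  rw [sqrtOneAddSq, ← Complex.exp_nat_mul, Nat.cast_two, mul_div_cancel₀ _ two_ne_zero,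
    Complex.exp_log (Complex.slitPlane_ne_zero hz)]

theorem sqrtOneAddSq_re_pos (hz : 1 + z ^ 2 ∈ Complex.slitPlane) : 0 < (sqrtOneAddSq z).re := by
  have h1 : (Complex.log (1 + z ^ 2) / 2).im = (1 + z ^ 2).arg / 2 := by
    rw [Complex.div_ofNat_im, Complex.log_im]
  have h2 := Complex.neg_pi_lt_arg (1 + z ^ 2)
  have h3 := (Complex.arg_le_pi (1 + z ^ 2)).lt_of_ne (Complex.mem_slitPlane_iff_arg.1 hz).1
  rw [sqrtOneAddSq, Complex.exp_re, h1]
  exact mul_pos (Real.exp_pos _) (Real.cos_pos_of_mem_Ioo ⟨by linarith, by linarith⟩)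

theorem sqrtOneAddSq_ne_zero : sqrtOneAddSq z ≠ 0 := Complex.exp_ne_zero _

theorem toHalfPlane_mul (hz : 1 + z ^ 2 ∈ Complex.slitPlane) :
    toHalfPlane z * (sqrtOneAddSq z - z) = 1 := by
  rw [toHalfPlane]
  linear_combination sqrtOneAddSq_sq hz

theorem toHalfPlane_inv (hz : 1 + z ^ 2 ∈ Complex.slitPlane) :
    (toHalfPlane z)⁻¹ = sqrtOneAddSq z - z :=
  inv_eq_of_mul_eq_one_right (toHalfPlane_mul hz)

theorem toHalfPlane_ne_zero (hz : 1 + z ^ 2 ∈ Complex.slitPlane) : toHalfPlane z ≠ 0 :=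
  left_ne_zero_of_mul_eq_one (toHalfPlane_mul hz)

theorem toHalfPlane_re_pos (hz : 1 + z ^ 2 ∈ Complex.slitPlane) : 0 < (toHalfPlane z).re := by
  have h1 : (toHalfPlane z).re + (toHalfPlane z)⁻¹.re = 2 * (sqrtOneAddSq z).re := by
    rw [toHalfPlane_inv hz, toHalfPlane, Complex.add_re, Complex.sub_re]; ring
  have h2 := sqrtOneAddSq_re_pos hz
  have h3 := Complex.normSq_pos.2 (toHalfPlane_ne_zero hz)
  by_contra! h
  have h4 : (toHalfPlane z)⁻¹.re ≤ 0 := by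
    rw [Complex.inv_re]
    exact div_nonpos_of_nonpos_of_nonneg h h3.le
  linarith

theorem re_le_norm_toHalfPlane (hz : 1 + z ^ 2 ∈ Complex.slitPlane) :
    z.re ≤ ‖toHalfPlane z‖ := by
  have h1 : z.re + (sqrtOneAddSq z).re ≤ ‖toHalfPlane z‖ := Complex.re_le_norm (toHalfPlane z)
  linarith [sqrtOneAddSq_re_pos hz]

theorem neg_re_le_inv_norm_toHalfPlane (hz : 1 + z ^ 2 ∈ Complex.slitPlane) :
    -z.re ≤ ‖toHalfPlane z‖⁻¹ := by
  have h1 := Complex.re_le_norm (toHalfPlane z)⁻¹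
  rw [norm_inv, toHalfPlane_inv hz, Complex.sub_re] at h1
  linarith [sqrtOneAddSq_re_pos hz]

theorem hasDerivAt_toHalfPlane (hz : 1 + z ^ 2 ∈ Complex.slitPlane) :
    HasDerivAt toHalfPlane (toHalfPlane z / sqrtOneAddSq z) z := by
  have h1 : HasDerivAt (fun z : ℂ => 1 + z ^ 2) (2 * z) z := by
    simpa using (hasDerivAt_pow 2 z).const_add 1
  have h2 := (hasDerivAt_id z).add (((h1.clog hz).div_const 2).cexp)
  refine h2.congr_deriv ?_
  have hu : sqrtOneAddSq z ≠ 0 := sqrtOneAddSq_ne_zero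
  change 1 + sqrtOneAddSq z * (2 * z / (1 + z ^ 2) / 2) = _
  rw [← sqrtOneAddSq_sq hz, toHalfPlane]
  field_simp
  ring

theorem one_add_sq_ofReal_mem_slitPlane (x : ℝ) : 1 + (x : ℂ) ^ 2 ∈ Complex.slitPlane :=
  one_add_sq_mem_slitPlane (fun h => by simpa using h.2.trans_lt' one_pos)
    (fun h => by have := h.2; simp at this; linarith)

theorem sqrtOneAddSq_sinh (x : ℝ) : sqrtOneAddSq (Real.sinh x) = Real.cosh x := by
  have hz := one_add_sq_ofReal_mem_slitPlane (Real.sinh x)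
  have h1 : sqrtOneAddSq (Real.sinh x) ^ 2 = (Real.cosh x : ℂ) ^ 2 := by
    rw [sqrtOneAddSq_sq hz]
    exact_mod_cast (by rw [Real.cosh_sq]; ring : 1 + Real.sinh x ^ 2 = Real.cosh x ^ 2)
  refine (sq_eq_sq_iff_eq_or_eq_neg.1 h1).resolve_right fun h => ?_
  have h2 := sqrtOneAddSq_re_pos hz
  rw [h, Complex.neg_re, Complex.ofReal_re] at h2
  linarith [Real.cosh_pos x]

theorem toHalfPlane_sinh (x : ℝ) : toHalfPlane (Real.sinh x) = Real.exp x := by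
  rw [toHalfPlane, sqrtOneAddSq_sinh, ← Complex.ofReal_add, Real.sinh_add_cosh]

/-- The dyadic scale of the image of a point of the doubly slit plane in the right half-plane. -/
noncomputable def dyadicIndex (z : ℂ) : ℤ := Int.log 2 ‖toHalfPlane z‖

theorem zpow_dyadicIndex_le (hz : 1 + z ^ 2 ∈ Complex.slitPlane) :
    2 ^ dyadicIndex z ≤ ‖toHalfPlane z‖ := by
  exact_mod_cast Int.zpow_log_le_self (b := 2) one_lt_two (norm_pos_iff.2 (toHalfPlane_ne_zero hz))

theorem norm_le_zpow_dyadicIndex (z : ℂ) : ‖toHalfPlane z‖ ≤ 2 * 2 ^ dyadicIndex z := by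
  have := Int.lt_zpow_succ_log_self (b := 2) one_lt_two ‖toHalfPlane z‖
  rw [zpow_add_one₀ (by norm_num), mul_comm] at this
  exact_mod_cast this.le

theorem dyadicIndex_sinh (m : ℤ) : dyadicIndex (Real.sinh (m * Real.log 2)) = m := by
  rw [dyadicIndex, toHalfPlane_sinh, Complex.norm_real, Real.norm_of_nonneg (Real.exp_pos _).le,
    mul_comm, Real.exp_mul, Real.exp_log two_pos, Real.rpow_intCast]
  exact_mod_cast Int.log_zpow (R := ℝ) (b := 2) one_lt_two m

theorem tendsto_dyadicIndex_atTop {D : Set ℂ} (hD : ∀ z ∈ D, 1 + z ^ 2 ∈ Complex.slitPlane) :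
    Tendsto dyadicIndex (comap Complex.re atTop ⊓ 𝓟 D) atTop := by
  refine tendsto_atTop.2 fun k => ?_
  filter_upwards [mem_inf_of_right (mem_principal_self D), mem_inf_of_left
    (tendsto_comap.eventually (eventually_ge_atTop ((2 : ℝ) ^ k)))] with z hz h
  refine (Int.zpow_le_iff_le_log one_lt_two (norm_pos_iff.2 (toHalfPlane_ne_zero (hD z hz)))).1 ?_
  exact_mod_cast h.trans (re_le_norm_toHalfPlane (hD z hz))

theorem tendsto_dyadicIndex_atBot {D : Set ℂ} (hD : ∀ z ∈ D, 1 + z ^ 2 ∈ Complex.slitPlane) :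
    Tendsto dyadicIndex (comap Complex.re atBot ⊓ 𝓟 D) atBot := by
  refine tendsto_atBot.2 fun k => ?_
  filter_upwards [mem_inf_of_right (mem_principal_self D), mem_inf_of_left
    (tendsto_comap.eventually (eventually_lt_atBot (-((2 : ℝ) ^ k)⁻¹)))] with z hz h
  have hpos := norm_pos_iff.2 (toHalfPlane_ne_zero (hD z hz))
  refine ((Int.lt_zpow_iff_log_lt one_lt_two hpos).1 ?_).le
  have h2 : ((2 : ℝ) ^ k)⁻¹ < ‖toHalfPlane z‖⁻¹ := by
    linarith [neg_re_le_inv_norm_toHalfPlane (hD z hz)]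
  exact_mod_cast (inv_lt_inv₀ (by positivity) hpos).1 h2

theorem tendsto_sinh_mul_log_atTop :
    Tendsto (fun m : ℤ => Real.sinh (m * Real.log 2)) atTop atTop :=
  Real.sinhOrderIso.tendsto_atTop.comp
    (tendsto_intCast_atTop_atTop.atTop_mul_const (Real.log_pos one_lt_two))

theorem tendsto_sinh_mul_log_atBot :
    Tendsto (fun m : ℤ => Real.sinh (m * Real.log 2)) atBot atBot :=
  Real.sinhOrderIso.tendsto_atBot.comp
    (tendsto_intCast_atBot_iff.2 tendsto_id |>.atBot_mul_const (Real.log_pos one_lt_two))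

end SlitPlane

theorem tendsto_atBot_int_of_neg_nat {α : Type*} {f : ℤ → α} {g : ℕ → α} {l : Filter α}
    (h : ∀ n : ℕ, f (-(n + 1 : ℕ)) = g n) (hg : Tendsto g atTop l) : Tendsto f atBot l := by
  rw [← map_neg_atTop, tendsto_map'_iff, ← Nat.map_cast_int_atTop, tendsto_map'_iff,
    ← tendsto_add_atTop_iff_nat 1]
  exact hg.congr fun n => (h n).symm

theorem tendsto_atTop_int_of_nat {α : Type*} {f : ℤ → α} {g : ℕ → α} {l : Filter α}
    (h : ∀ n : ℕ, f n = g n) (hg : Tendsto g atTop l) : Tendsto f atTop l := by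
  rw [← Nat.map_cast_int_atTop, tendsto_map'_iff]
  exact hg.congr fun n => (h n).symm

/-- There is a bi-infinite walk in the plane with slowly varying increments, having prescribed
continua as cluster sets at both ends, whose increments turn around infinitely often. -/
theorem exists_int_walk {ε : ℝ} (hε : 0 < ε) {Kneg Kpos : Set (OnePoint ℂ)}
    (hKnegC : IsCompact Kneg) (hKnegConn : IsConnected Kneg)
    (hKposC : IsCompact Kpos) (hKposConn : IsConnected Kpos) :
    ∃ p c : ℤ → ℂ, p 0 = 0 ∧ (∀ n, p (n + 1) = p n + c n) ∧ (∀ n, c n ≠ 0) ∧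
      (∀ n, ‖c (n + 1) - c n‖ ≤ ε * ‖c n‖ ∧ ‖c (n + 1) - c n‖ ≤ ε * ‖c (n + 1)‖) ∧
      (Tendsto c atTop (𝓝 0) ∧ Tendsto c atBot (𝓝 0)) ∧
      (∀ w, MapClusterPt w atTop (fun n => (p n : OnePoint ℂ)) ↔ w ∈ Kpos) ∧
      (∀ w, MapClusterPt w atBot (fun n => (p n : OnePoint ℂ)) ↔ w ∈ Kneg) ∧
      (∃ σ : ℕ → ℤ, Tendsto σ atTop atTop ∧ ∀ n, ∃ r : ℝ, 0 < r ∧ c (σ n) = (-1) ^ n * r) ∧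
      ∃ σ : ℕ → ℤ, Tendsto σ atTop atBot ∧ ∀ n, ∃ r : ℝ, 0 < r ∧ c (σ n) = (-1) ^ n * r := by
  obtain ⟨x, hx, hxK⟩ := exists_seq_clusterSet_eq hKposC hKposConn
  obtain ⟨y, hy, hyK⟩ := exists_seq_clusterSet_eq hKnegC hKnegConn
  obtain ⟨p, c, τ, p0, c0, hp, hc, hslow, hlim, hτ, hturn, hpx⟩ :=
    exists_slow_walk hε (u := 1) (by simp) hx
  obtain ⟨p', c', τ', p0', c0', hp', hc', hslow', hlim', hτ', hturn', hpy⟩ :=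
    exists_slow_walk hε (u := -1) (by simp) hy
  let P : ℤ → ℂ := fun n => if 0 ≤ n then p n.toNat else p' (-n).toNat
  let C : ℤ → ℂ := fun n => if 0 ≤ n then c n.toNat else -c' (-n - 1).toNat
  have hP : ∀ n : ℕ, P n = p n := fun n => by simp [P]
  have hP' : ∀ n : ℕ, P (-(n + 1 : ℕ)) = p' (n + 1) := fun n => by
    simp only [P]; rw [if_neg (by omega), neg_neg, Int.toNat_natCast]
  have hP'' : ∀ n : ℕ, P (-(n : ℤ)) = p' n := fun n => by
    cases n with
    | zero => simp [P, p0, p0']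
    | succ n => exact hP' n
  have hC : ∀ n : ℕ, C n = c n := fun n => by simp [C]
  have hC' : ∀ n : ℕ, C (-(n + 1 : ℕ)) = -c' n := fun n => by
    simp only [C]; rw [if_neg (by omega)]; congr 2; omega
  have split : ∀ {Q : ℤ → Prop}, (∀ n : ℕ, Q n) → (∀ n : ℕ, Q (-(n + 1 : ℕ))) → ∀ n, Q n := by
    intro Q h1 h2 n
    cases n with
    | ofNat n => exact h1 n
    | negSucc n => exact h2 n
  refine ⟨P, C, by simpa [p0] using hP 0, split (fun n => ?_) fun n => ?_,
    split (fun n => by rw [hC]; exact hc n) fun n => by rw [hC']; exact neg_ne_zero.2 (hc' n),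
    split (fun n => ?_) fun n => ?_, ⟨tendsto_atTop_int_of_nat hC hlim,
      tendsto_atBot_int_of_neg_nat hC' (by simpa using hlim'.neg)⟩,
    fun w => ?_, fun w => ?_, ?_, ?_⟩
  · rw [← Nat.cast_succ, hP, hP, hC, hp]
  · rw [hP', hC', hp', show -((n + 1 : ℕ) : ℤ) + 1 = -(n : ℤ) by push_cast; ring, hP'']
    ring
  · rw [← Nat.cast_succ, hC, hC]
    exact hslow n
  · cases n with
    | zero =>
      rw [hC', show -((0 + 1 : ℕ) : ℤ) + 1 = (0 : ℕ) by simp, hC, c0, c0']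
      simpa using hε.le
    | succ n =>
      rw [hC', show -((n + 1 + 1 : ℕ) : ℤ) + 1 = -(n + 1 : ℕ) by push_cast; ring, hC', norm_neg,
        norm_neg, neg_sub_neg]
      exact (hslow' n).symm
  · rw [← hxK, ← hpx, MapClusterPt, ← Nat.map_cast_int_atTop, map_map, MapClusterPt]
    simp only [Function.comp_def, hP]
  · rw [← hyK, ← hpy, MapClusterPt, ← map_neg_atTop, ← Nat.map_cast_int_atTop, map_map, map_map,
      MapClusterPt]
    simp only [Function.comp_def, hP'']
  · refine ⟨fun n => τ n, tendsto_natCast_atTop_atTop.comp hτ, fun n => ?_⟩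
    obtain ⟨r, hr, h⟩ := hturn n
    exact ⟨r, hr, by rw [hC, h, mul_one]⟩
  · refine ⟨fun n => -(τ' n + 1 : ℕ), tendsto_neg_atTop_atBot.comp
      (tendsto_natCast_atTop_atTop.comp ((tendsto_add_atTop_nat 1).comp hτ')), fun n => ?_⟩
    obtain ⟨r, hr, h⟩ := hturn' n
    exact ⟨r, hr, by rw [hC', h]; ring⟩

section Interpolation

variable {p c : ℤ → ℂ} {z : ℂ}

theorem exists_deriv_interpSeries_toHalfPlane_eq (hcne : ∀ n, c n ≠ 0)
    (hc : ∀ n, ‖c (n + 1) - c n‖ ≤ 1 / 400 * ‖c n‖ ∧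
      ‖c (n + 1) - c n‖ ≤ 1 / 400 * ‖c (n + 1)‖)
    (hz : 1 + z ^ 2 ∈ Complex.slitPlane) :
    DifferentiableAt ℂ (fun z => interpSeries c (toHalfPlane z)) z ∧
    ∃ v : ℂ, deriv (fun z => interpSeries c (toHalfPlane z)) z =
      c (dyadicIndex z) * v / sqrtOneAddSq z ∧ 1 / 25 ≤ v.re ∧ ‖v‖ ≤ 8 := by
  have hq := toHalfPlane_re_pos hz
  obtain ⟨v, hv, h⟩ := exists_deriv_interpSeries_eq hc hq (hcne (dyadicIndex z))
    (zpow_dyadicIndex_le hz) (norm_le_zpow_dyadicIndex z)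
  have hd := (interpSeries_differentiableAt_and_hasSum_deriv (by norm_num) (by norm_num) hc
    hq).1.hasDerivAt.comp z (hasDerivAt_toHalfPlane hz)
  refine ⟨hd.differentiableAt, v, ?_, h⟩
  have hq0 := toHalfPlane_ne_zero hz
  refine hd.deriv.trans ?_
  rw [hv]
  field_simp

theorem le_re_unit_tangent (hcne : ∀ n, c n ≠ 0)
    (hc : ∀ n, ‖c (n + 1) - c n‖ ≤ 1 / 400 * ‖c n‖ ∧
      ‖c (n + 1) - c n‖ ≤ 1 / 400 * ‖c (n + 1)‖) {m : ℤ} {n : ℕ} {r : ℝ} (hr : 0 < r)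
    (hm : c m = (-1) ^ n * r) {G : ℂ → ℂ} (hG : G = fun z => interpSeries c (toHalfPlane z)) :
    1 / 200 ≤ (-1) ^ n * (deriv G (Real.sinh (m * Real.log 2)) /
      ‖deriv G (Real.sinh (m * Real.log 2))‖).re := by
  obtain ⟨-, v, hv, hre, hnorm⟩ := exists_deriv_interpSeries_toHalfPlane_eq hcne hc
    (one_add_sq_ofReal_mem_slitPlane (Real.sinh (m * Real.log 2)))
  rw [dyadicIndex_sinh, sqrtOneAddSq_sinh, hm] at hv
  rw [hG, hv]
  have hv0 : 0 < ‖v‖ := (by norm_num : (0 : ℝ) < 1 / 25).trans_le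
    (hre.trans (Complex.re_le_norm v))
  set s := Real.cosh (m * Real.log 2)
  have hs : 0 < s := Real.cosh_pos _
  have e : ((-1 : ℂ) ^ n * r * v / s) / ‖(-1 : ℂ) ^ n * r * v / s‖ =
      (((-1) ^ n / ‖v‖ : ℝ) : ℂ) * v := by
    have : ‖(-1 : ℂ) ^ n * r * v / s‖ = r * ‖v‖ / s := by
      simp [abs_of_pos hr, abs_of_pos hs]
    rw [this]
    have h1 : (r : ℂ) ≠ 0 := Complex.ofReal_ne_zero.2 hr.ne'
    have h2 : (s : ℂ) ≠ 0 := Complex.ofReal_ne_zero.2 hs.ne'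
    have h3 : (‖v‖ : ℂ) ≠ 0 := Complex.ofReal_ne_zero.2 hv0.ne'
    push_cast
    field_simp
  rw [e, Complex.re_ofReal_mul, ← mul_assoc, ← mul_div_assoc, ← mul_pow]
  norm_num
  rw [inv_mul_eq_div, le_div_iff₀ hv0]
  linarith

end Interpolation

end OnePointCluster

open OnePointCluster

/-- On the doubly slit plane `D = ℂ \ ([+i, +i∞) ∪ [-i, -i∞))`, for any two continua `K⁻`, `K⁺`
of the Riemann sphere there exists a locally conformal (analytic, nonvanishing derivative)
function `G` whose real restriction has cluster set `K⁻` at `-∞` and `K⁺` at `+∞`, whose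
cluster sets in `D` as `Re z → ±∞` are exactly `K∓`, and whose normalized tangent direction
along the real line diverges at both ends. -/
theorem doubly_slit_plane_locally_conformal_with_prescribed_cluster_sets
    (D : Set ℂ)
    (hD : D = {z : ℂ | ¬ (z.re = 0 ∧ 1 ≤ z.im)} ∩ {z : ℂ | ¬ (z.re = 0 ∧ z.im ≤ -1)})
    (Kneg Kpos : Set (OnePoint ℂ))
    (hKnegC : IsCompact Kneg) (hKnegConn : IsConnected Kneg)
    (hKposC : IsCompact Kpos) (hKposConn : IsConnected Kpos) :
    ∃ G : ℂ → ℂ, AnalyticOnNhd ℂ G D ∧ (∀ z ∈ D, deriv G z ≠ 0) ∧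
      {w : OnePoint ℂ | MapClusterPt w atBot fun t : ℝ => ((G t : ℂ) : OnePoint ℂ)} = Kneg ∧
      {w : OnePoint ℂ | MapClusterPt w atTop fun t : ℝ => ((G t : ℂ) : OnePoint ℂ)} = Kpos ∧
      (∀ w : OnePoint ℂ, w ∈ Kpos ↔ ∃ z : ℕ → ℂ, (∀ n, z n ∈ D) ∧
        Tendsto (fun n => (z n).re) atTop atTop ∧
        Tendsto (fun n => ((G (z n) : ℂ) : OnePoint ℂ)) atTop (𝓝 w)) ∧
      (∀ w : OnePoint ℂ, w ∈ Kneg ↔ ∃ z : ℕ → ℂ, (∀ n, z n ∈ D) ∧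
        Tendsto (fun n => (z n).re) atTop atBot ∧
        Tendsto (fun n => ((G (z n) : ℂ) : OnePoint ℂ)) atTop (𝓝 w)) ∧
      (¬ ∃ c : ℂ, Tendsto (fun t : ℝ => deriv G t / ‖deriv G t‖) atTop (𝓝 c)) ∧
      (¬ ∃ c : ℂ, Tendsto (fun t : ℝ => deriv G t / ‖deriv G t‖) atBot (𝓝 c)) := by
  obtain ⟨p, c, hp0, hp, hcne, hc, ⟨hcT, hcB⟩, hKT, hKB, ⟨σ, hσ, hσc⟩, ⟨σ', hσ', hσc'⟩⟩ :=
    exists_int_walk (ε := 1 / 400) (by norm_num) hKnegC hKnegConn hKposC hKposConn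
  have hslit : ∀ z ∈ D, 1 + z ^ 2 ∈ Complex.slitPlane := by
    intro z hz
    rw [hD] at hz
    exact one_add_sq_mem_slitPlane hz.1 hz.2
  have hreal : ∀ x : ℝ, (x : ℂ) ∈ D := by
    intro x
    rw [hD]
    constructor <;> rintro ⟨-, h⟩ <;> norm_num at h
  have hopen : IsOpen D := by
    rw [hD]
    refine IsOpen.inter ?_ ?_
    · exact ((isClosed_eq Complex.continuous_re continuous_const).inter
        (isClosed_le continuous_const Complex.continuous_im)).isOpen_compl
    · exact ((isClosed_eq Complex.continuous_re continuous_const).inter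
        (isClosed_le Complex.continuous_im continuous_const)).isOpen_compl
  set G : ℂ → ℂ := fun z => interpSeries c (toHalfPlane z) with hG
  have hbound : ∀ z ∈ D, ‖G z - p (dyadicIndex z)‖ ≤ 8 * ‖c (dyadicIndex z)‖ := by
    intro z hz
    refine (norm_interpSeries_sub_le (by norm_num) (by norm_num) hc hp0 hp
      (toHalfPlane_re_pos (hslit z hz)) (zpow_dyadicIndex_le (hslit z hz))
      (norm_le_zpow_dyadicIndex z)).trans ?_
    rw [mul_assoc, mul_comm]
    gcongr
    norm_num
  have hderiv := fun z hz => exists_deriv_interpSeries_toHalfPlane_eq hcne hc (hslit z hz)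
  obtain ⟨hT1, hT2⟩ := clusterSet_eq_of_norm_sub_le hreal (tendsto_dyadicIndex_atTop hslit) hbound
    hcT tendsto_sinh_mul_log_atTop dyadicIndex_sinh hKT
  obtain ⟨hB1, hB2⟩ := clusterSet_eq_of_norm_sub_le hreal (tendsto_dyadicIndex_atBot hslit) hbound
    hcB tendsto_sinh_mul_log_atBot dyadicIndex_sinh hKB
  refine ⟨G, ?_, ?_, hB1, hT1, hT2, hB2, ?_, ?_⟩
  · exact DifferentiableOn.analyticOnNhd
      (fun z hz => (hderiv z hz).1.differentiableWithinAt) hopen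
  · intro z hz
    obtain ⟨-, v, hv, hre, -⟩ := hderiv z hz
    rw [hv]
    have hv0 : v ≠ 0 := by
      rintro rfl
      norm_num at hre
    exact div_ne_zero (mul_ne_zero (hcne _) hv0) sqrtOneAddSq_ne_zero
  · refine not_tendsto_of_alternating (tendsto_sinh_mul_log_atTop.comp hσ)
      (by norm_num : (0 : ℝ) < 1 / 200) fun n => ?_
    obtain ⟨r, hr, h⟩ := hσc n
    exact le_re_unit_tangent hcne hc hr h hG
  · refine not_tendsto_of_alternating (tendsto_sinh_mul_log_atBot.comp hσ')
      (by norm_num : (0 : ℝ) < 1 / 200) fun n => ?_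
    obtain ⟨r, hr, h⟩ := hσc' n
    exact le_re_unit_tangent hcne hc hr h hG
end

section
/- Let t₁ < t₂ < t₃ be real numbers and let z₁, z₂, z₃ ∈ ℂ be non-collinear points. For j = 1, 2 let σⱼ : [tⱼ, tⱼ₊₁] → ℂ be the affine parametrization σⱼ(t) = zⱼ + ((t − tⱼ)/(tⱼ₊₁ − tⱼ))·(zⱼ₊₁ − zⱼ). Then for every ε > 0 there exists δ₀ > 0 such that for all 0 < δ < δ₀ there is a function σ_δ : ℝ → ℂ that is continuously differentiable (C¹) on [t₁, t₃], satisfies σ_δ(t) = σ₁(t) for t₁ ≤ t ≤ t₂ − δ and σ_δ(t) = σ₂(t) for t₂ + δ ≤ t ≤ t₃, has derivative σ_δ′(t) ≠ 0 for all t ∈ [t₁, t₃], and satisfies |σ_δ(t) − σⱼ(t)| < ε for all t ∈ [tⱼ, tⱼ₊₁], j = 1, 2. -/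
open Set

theorem hasDerivAt_max_zero_sq (x : ℝ) :
    HasDerivAt (fun y : ℝ => max 0 y ^ 2) (2 * max 0 x) x := by
  rcases lt_trichotomy x 0 with hx | rfl | hx
  · rw [max_eq_left hx.le, mul_zero]
    refine (hasDerivAt_const x (0 : ℝ)).congr_of_eventuallyEq ?_
    filter_upwards [eventually_lt_nhds hx] with y hy
    simp [max_eq_left hy.le]
  · have hO : (fun y : ℝ => max 0 y ^ 2) =O[nhds 0] fun y => ‖y - 0‖ ^ 2 := by
      refine Asymptotics.isBigO_of_le _ fun y => ?_
      rw [sub_zero, norm_pow, norm_pow, norm_norm]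
      gcongr
      rw [Real.norm_of_nonneg (le_max_left 0 y)]
      exact max_le (norm_nonneg y) (Real.le_norm_self y)
    simpa [hasDerivAt_iff_hasFDerivAt] using hO.hasFDerivAt one_lt_two
  · rw [max_eq_right hx.le]
    have h := hasDerivAt_pow 2 x
    refine HasDerivAt.congr_of_eventuallyEq (by simpa using h) ?_
    filter_upwards [eventually_gt_nhds hx] with y hy
    simp [max_eq_right hy.le]

/-- A `C¹` approximation of `s ↦ max 0 s` that agrees with it outside `(-δ, δ)`. -/
noncomputable def smoothRamp (δ s : ℝ) : ℝ :=
  (max 0 (s + δ) ^ 2 - max 0 (s - δ) ^ 2) / (4 * δ)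

theorem hasDerivAt_smoothRamp (δ s : ℝ) :
    HasDerivAt (smoothRamp δ) ((2 * max 0 (s + δ) - 2 * max 0 (s - δ)) / (4 * δ)) s :=
  (((hasDerivAt_max_zero_sq (s + δ)).comp_add_const s δ).sub
    ((hasDerivAt_max_zero_sq (s - δ)).comp_sub_const s δ)).div_const (4 * δ)

theorem contDiff_smoothRamp (δ : ℝ) : ContDiff ℝ 1 (smoothRamp δ) := by
  rw [contDiff_one_iff_deriv]
  refine ⟨fun s => (hasDerivAt_smoothRamp δ s).differentiableAt, ?_⟩
  rw [show deriv (smoothRamp δ) = _ from funext fun s => (hasDerivAt_smoothRamp δ s).deriv]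
  fun_prop

theorem smoothRamp_of_le {δ s : ℝ} (hδ : 0 < δ) (hs : s ≤ -δ) : smoothRamp δ s = 0 := by
  rw [smoothRamp, max_eq_left (by linarith), max_eq_left (by linarith)]
  simp

theorem smoothRamp_of_ge {δ s : ℝ} (hδ : 0 < δ) (hs : δ ≤ s) : smoothRamp δ s = s := by
  rw [smoothRamp, max_eq_right (by linarith), max_eq_right (by linarith)]
  field_simp
  ring

theorem abs_smoothRamp_sub_max_le {δ : ℝ} (hδ : 0 < δ) (s : ℝ) :
    |smoothRamp δ s - max 0 s| ≤ δ := by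
  rcases le_total s (-δ) with h₁ | h₁
  · rw [smoothRamp_of_le hδ h₁, max_eq_left (by linarith)]
    simpa using hδ.le
  rcases le_total δ s with h₂ | h₂
  · rw [smoothRamp_of_ge hδ h₂, max_eq_right (by linarith)]
    simpa using hδ.le
  have h : smoothRamp δ s = (s + δ) ^ 2 / (4 * δ) := by
    rw [smoothRamp, max_eq_right (by linarith), max_eq_left (by linarith)]
    simp
  rw [h, abs_sub_le_iff, sub_le_iff_le_add, sub_le_comm, div_le_iff₀ (by positivity),
    le_div_iff₀ (by positivity)]
  rcases le_total 0 s with hs | hs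
  · rw [max_eq_right hs]
    constructor <;> nlinarith
  · rw [max_eq_left hs]
    constructor <;> nlinarith

theorem collinear_of_smul_sub_add_smul_sub_eq_zero {V : Type*} [AddCommGroup V] [Module ℝ V]
    {p q r : V} {a b : ℝ} (hab : a ≠ 0 ∨ b ≠ 0) (h : a • (q - p) + b • (r - q) = 0) :
    Collinear ℝ ({p, q, r} : Set V) := by
  rw [collinear_iff_of_mem (p₀ := q) (by simp)]
  rcases hab with ha | hb
  · refine ⟨r - q, ?_⟩
    simp only [mem_insert_iff, mem_singleton_iff, forall_eq_or_imp, forall_eq, vadd_eq_add]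
    refine ⟨⟨b / a, ?_⟩, ⟨0, by simp⟩, ⟨1, by simp⟩⟩
    have h' : q - p = -((b / a) • (r - q)) := by
      rw [← inv_smul_smul₀ ha (q - p), eq_neg_of_add_eq_zero_left h, smul_neg, smul_smul,
        inv_mul_eq_div]
    rw [← sub_eq_iff_eq_add, ← neg_sub, h', neg_neg]
  · refine ⟨q - p, ?_⟩
    simp only [mem_insert_iff, mem_singleton_iff, forall_eq_or_imp, forall_eq, vadd_eq_add]
    refine ⟨⟨-1, by simp⟩, ⟨0, by simp⟩, ⟨-(a / b), ?_⟩⟩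
    rw [← sub_eq_iff_eq_add, ← inv_smul_smul₀ hb (r - q), eq_neg_of_add_eq_zero_right h, smul_neg,
      smul_smul, inv_mul_eq_div, neg_smul]

/-- Corner-smoothing lemma: the corner at `z₂` of the two-segment polygonal path through
non-collinear points `z₁, z₂, z₃` can be replaced, near the parameter `t₂`, by a `C¹`
regular curve that agrees with the segments outside `(t₂ - δ, t₂ + δ)` and is uniformly
`ε`-close to each segment. -/
theorem corner_smoothing
    (t₁ t₂ t₃ : ℝ) (h₁₂ : t₁ < t₂) (h₂₃ : t₂ < t₃)
    (z₁ z₂ z₃ : ℂ) (hnc : ¬ Collinear ℝ ({z₁, z₂, z₃} : Set ℂ))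
    (σ₁ σ₂ : ℝ → ℂ)
    (hσ₁ : ∀ t : ℝ, σ₁ t = z₁ + (((t - t₁) / (t₂ - t₁) : ℝ) : ℂ) * (z₂ - z₁))
    (hσ₂ : ∀ t : ℝ, σ₂ t = z₂ + (((t - t₂) / (t₃ - t₂) : ℝ) : ℂ) * (z₃ - z₂))
    (ε : ℝ) (hε : 0 < ε) :
    ∃ δ₀ > (0 : ℝ), ∀ δ : ℝ, 0 < δ → δ < δ₀ →
      ∃ σ : ℝ → ℂ,
        ContDiffOn ℝ 1 σ (Icc t₁ t₃) ∧
        (∀ t ∈ Icc t₁ (t₂ - δ), σ t = σ₁ t) ∧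
        (∀ t ∈ Icc (t₂ + δ) t₃, σ t = σ₂ t) ∧
        (∀ t ∈ Icc t₁ t₃, deriv σ t ≠ 0) ∧
        (∀ t ∈ Icc t₁ t₂, ‖σ t - σ₁ t‖ < ε) ∧
        (∀ t ∈ Icc t₂ t₃, ‖σ t - σ₂ t‖ < ε) := by
  have hd₁ : t₂ - t₁ ≠ 0 := (sub_pos.2 h₁₂).ne'
  have hd₂ : t₃ - t₂ ≠ 0 := (sub_pos.2 h₂₃).ne'
  set u : ℂ := (t₂ - t₁)⁻¹ • (z₂ - z₁) with hu
  set v : ℂ := (t₃ - t₂)⁻¹ • (z₃ - z₂) with hv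
  have hσ₁' (t : ℝ) : σ₁ t = z₂ + (t - t₂) • u := by
    have hd : ((t₂ : ℂ) - t₁) ≠ 0 := by exact_mod_cast hd₁
    rw [hσ₁, hu]
    simp only [Complex.real_smul]
    push_cast
    field_simp
    ring
  have hσ₂' (t : ℝ) : σ₂ t = z₂ + (t - t₂) • v := by
    rw [hσ₂, hv, smul_smul, ← div_eq_mul_inv, Complex.real_smul]
  have hne (c : ℝ) : u + c • (v - u) ≠ 0 := by
    intro h
    refine hnc (collinear_of_smul_sub_add_smul_sub_eq_zero
      (a := (1 - c) * (t₂ - t₁)⁻¹) (b := c * (t₃ - t₂)⁻¹) ?_ ?_)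
    · by_cases hc : c = 0
      · simp [hc, hd₁]
      · simp [hc, hd₂]
    · rw [mul_smul, mul_smul, ← hu, ← hv, ← h]
      module
  refine ⟨ε / (‖v - u‖ + 1), by positivity, fun δ hδ hδε => ?_⟩
  have hbound (s : ℝ) : ‖(smoothRamp δ s - max 0 s) • (v - u)‖ < ε := by
    rw [norm_smul, Real.norm_eq_abs]
    calc |smoothRamp δ s - max 0 s| * ‖v - u‖ ≤ δ * ‖v - u‖ := by
          gcongr
          exact abs_smoothRamp_sub_max_le hδ s
      _ < δ * (‖v - u‖ + 1) := by gcongr; linarith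
      _ < ε := (lt_div_iff₀ (by positivity)).1 hδε
  refine ⟨fun t => z₂ + ((t - t₂) • u + smoothRamp δ (t - t₂) • (v - u)), ?_, ?_, ?_, ?_, ?_, ?_⟩
  · have hramp : ContDiff ℝ 1 fun t => smoothRamp δ (t - t₂) :=
      (contDiff_smoothRamp δ).comp (contDiff_id.sub contDiff_const)
    exact ContDiff.contDiffOn (by fun_prop)
  · rintro t ⟨-, ht⟩
    simp [hσ₁', smoothRamp_of_le hδ (show t - t₂ ≤ -δ by linarith)]
  · rintro t ⟨ht, -⟩
    simp only [hσ₂', smoothRamp_of_ge hδ (show δ ≤ t - t₂ by linarith)]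
    module
  · intro t _
    have h := ((((hasDerivAt_id t).sub_const t₂).smul_const u).add
      (((hasDerivAt_smoothRamp δ (t - t₂)).comp_sub_const t t₂).smul_const (v - u))).const_add z₂
    rw [one_smul] at h
    exact h.deriv.trans_ne (hne _)
  · rintro t ⟨-, ht⟩
    convert hbound (t - t₂) using 2
    rw [hσ₁', max_eq_left (sub_nonpos.2 ht)]
    module
  · rintro t ⟨ht, -⟩
    convert hbound (t - t₂) using 2
    rw [hσ₂', max_eq_right (sub_nonneg.2 ht)]
    module
end
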